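/- Let G be a topological group, p > 0, and let ψ : G → ℝ≥0 be a continuous function such that ψ(g) = ‖α_g(0)‖_{L_p}^p for some continuous affine isometric action α of G on an L_p space. Then there exist a standard σ-finite measure space (X,μ), a continuous nonsingular action σ of G on (X,μ), and a continuous map c : G → L_p(X,μ) satisfying the cocycle identity c(gh) = c(g) + σ^{p,μ}(g)c(h) for all g, h ∈ G, such that ψ(g) = ‖c(g)‖_{L_p}^p for all g ∈ G, where σ^{p,μ}(g)f = (d((σ_g)_*μ)/dμ)^{1/p} · (f∘σ_g^{-1}). -/

import Mathlib

open MeasureTheory ENNReal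

/-- The quantity `‖f‖_p^p = ∫ |f|^p dμ`, valued in `ℝ≥0∞`. -/
noncomputable def pPow {X : Type*} [MeasurableSpace X] (μ : Measure X) (p : ℝ)
    {E : Type*} [NormedAddCommGroup E] (f : X →ₘ[μ] E) : ℝ≥0∞ :=
  ∫⁻ x, (‖f x‖₊ : ℝ≥0∞) ^ p ∂μ

/-- A continuous affine isometric action of a topological group `G` on `L_p(X,μ)`. -/
structure AffineIsometricAction (G : Type*) [Group G] [TopologicalSpace G]
    {X : Type*} [MeasurableSpace X] (μ : Measure X) (p : ℝ) where
  act : G → Lp ℂ (ENNReal.ofReal p) μ → Lp ℂ (ENNReal.ofReal p) μ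
  act_one : ∀ f, act 1 f = f
  act_mul : ∀ g h f, act (g * h) f = act g (act h f)
  isometry : ∀ g f f',
    pPow μ p ((act g f : X →ₘ[μ] ℂ) - (act g f' : X →ₘ[μ] ℂ))
      = pPow μ p ((f : X →ₘ[μ] ℂ) - (f' : X →ₘ[μ] ℂ))
  affine : ∀ (g : G) (t : ℝ) (f f' : Lp ℂ (ENNReal.ofReal p) μ),
    act g (t • f + (1 - t) • f') = t • act g f + (1 - t) • act g f'
  continuous : ∀ (f : Lp ℂ (ENNReal.ofReal p) μ) (g₀ : G),
    Filter.Tendsto (fun g => pPow μ p ((act g f : X →ₘ[μ] ℂ) - (act g₀ f : X →ₘ[μ] ℂ)))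
      (nhds g₀) (nhds 0)

/-- A continuous nonsingular action of a topological group `G` on `(X,μ)`: a continuous
homomorphism to the Polish group `Aut(X,[μ])` of measure-class preserving automorphisms
of `(X,μ)` up to a.e. equality.  Continuity is expressed by the convergence
`(σ_g)_*ν → (σ_{g₀})_*ν` in total variation (computed via Radon–Nikodym derivatives
with respect to `μ`) for every probability measure `ν ≪ μ`. -/
structure NonsingularAction (G : Type*) [Group G] [TopologicalSpace G]
    {X : Type*} [MeasurableSpace X] (μ : Measure X) where
  σ : G → X → X
  measurable : ∀ g, Measurable (σ g)
  nonsingular : ∀ g, μ.map (σ g) ≪ μ ∧ μ ≪ μ.map (σ g)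
  σ_one : σ 1 =ᵐ[μ] id
  σ_mul : ∀ g h, σ (g * h) =ᵐ[μ] (σ g) ∘ (σ h)
  continuous : ∀ (ν : Measure X), IsProbabilityMeasure ν → ν ≪ μ → ∀ g₀ : G,
    Filter.Tendsto
      (fun g => ∫⁻ x, ((ν.map (σ g)).rnDeriv μ x - (ν.map (σ g₀)).rnDeriv μ x)
          + ((ν.map (σ g₀)).rnDeriv μ x - (ν.map (σ g)).rnDeriv μ x) ∂μ)
      (nhds g₀) (nhds 0)

section

open MeasureTheory ENNReal

open Filter Topology

/-- symmetric difference of extended nonnegative reals -/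
noncomputable def edl (a b : ℝ≥0∞) : ℝ≥0∞ := (a - b) + (b - a)

theorem edl_comm (a b : ℝ≥0∞) : edl a b = edl b a := by
  unfold edl; rw [add_comm]

theorem edl_triangle (a b c : ℝ≥0∞) : edl a c ≤ edl a b + edl b c := by
  unfold edl
  have h1 : a - c ≤ (a - b) + (b - c) := tsub_le_tsub_add_tsub
  have h2 : c - a ≤ (c - b) + (b - a) := tsub_le_tsub_add_tsub
  calc a - c + (c - a) ≤ ((a - b) + (b - c)) + ((c - b) + (b - a)) := add_le_add h1 h2
    _ = _ := by ring

theorem edl_mul (d : NNReal) (a b : ℝ≥0∞) : edl (d * a) (d * b) = d * edl a b := by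
  unfold edl
  rw [mul_add, ENNReal.mul_sub (fun _ _ => ENNReal.coe_ne_top),
    ENNReal.mul_sub (fun _ _ => ENNReal.coe_ne_top)]

theorem measurable_edl {Y : Type*} [MeasurableSpace Y] {f g : Y → ℝ≥0∞}
    (hf : Measurable f) (hg : Measurable g) : Measurable (fun y => edl (f y) (g y)) := by
  unfold edl; fun_prop

theorem scheffe {Y : Type*} [MeasurableSpace Y] {μ : Measure Y} (f : ℕ → Y → ℝ≥0∞)
    (f0 : Y → ℝ≥0∞) (hf : ∀ n, Measurable (f n)) (hf0 : Measurable f0)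
    (hIeq : ∀ n, ∫⁻ y, f n y ∂μ = ∫⁻ y, f0 y ∂μ) (hfin : ∫⁻ y, f0 y ∂μ ≠ ∞)
    (hlim : ∀ᵐ y ∂μ, Tendsto (fun n => f n y) atTop (𝓝 (f0 y))) :
    Tendsto (fun n => ∫⁻ y, edl (f n y) (f0 y) ∂μ) atTop (𝓝 0) := by
  have hfin' : ∀ᵐ y ∂μ, f0 y < ∞ := ae_lt_top hf0 hfin
  have h1 : Tendsto (fun n => ∫⁻ y, (f0 y - f n y) ∂μ) atTop (𝓝 0) := by
    have := tendsto_lintegral_of_dominated_convergence (μ := μ)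
      (F := fun n y => f0 y - f n y) (f := fun _ => 0) f0
      (fun n => hf0.sub (hf n)) (fun n => ae_of_all _ fun y => tsub_le_self) hfin (by
        filter_upwards [hlim, hfin'] with y hy hy'
        have := ENNReal.Tendsto.sub (tendsto_const_nhds (x := f0 y)) hy (Or.inl hy'.ne)
        simpa using this)
    simpa using this
  have h2 : ∀ n, ∫⁻ y, edl (f n y) (f0 y) ∂μ = 2 * ∫⁻ y, (f0 y - f n y) ∂μ := by
    intro n
    have e1 : ∫⁻ y, f n y + (f0 y - f n y) ∂μ = ∫⁻ y, f0 y + (f n y - f0 y) ∂μ := by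
      congr 1; ext y
      rw [add_tsub_eq_max, add_tsub_eq_max, max_comm]
    rw [lintegral_add_left (hf n), lintegral_add_left hf0, hIeq n] at e1
    have e2 := (ENNReal.add_right_inj hfin).1 e1
    unfold edl
    rw [lintegral_add_left (by have := hf n; fun_prop), ← e2, two_mul]
  simp_rw [h2]
  have := ENNReal.Tendsto.const_mul (a := 2) h1 (Or.inr (by simp))
  simpa using this

theorem approx_cont {Y : Type*} [TopologicalSpace Y] [TopologicalSpace.MetrizableSpace Y]
    [SecondCountableTopology Y] [MeasurableSpace Y] [BorelSpace Y] {μ : Measure Y}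
    [IsFiniteMeasure μ] (F : Y → ℝ≥0∞) (hF : Measurable F) (hfin : ∫⁻ y, F y ∂μ ≠ ∞)
    {ε : ℝ≥0∞} (hε : ε ≠ 0) :
    ∃ F' : Y → NNReal, Continuous F' ∧ (∫⁻ y, F' y ∂μ ≠ ∞) ∧ ∫⁻ y, edl (F y) (F' y) ∂μ ≤ ε := by
  have hfin' : ∀ᵐ y ∂μ, F y < ∞ := ae_lt_top hF hfin
  have hI : Integrable (fun y => (F y).toReal) μ :=
    integrable_toReal_of_lintegral_ne_top hF.aemeasurable hfin
  let _ := TopologicalSpace.metrizableSpaceMetric Y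
  obtain ⟨g, hg, hgi⟩ := hI.exists_boundedContinuous_lintegral_sub_le hε
  refine ⟨fun y => (g y).toNNReal, by fun_prop, ?_, ?_⟩
  · have : ∫⁻ y, ((g y).toNNReal : ℝ≥0∞) ∂μ ≤ ∫⁻ y, ‖g y‖ₑ ∂μ := by
      refine lintegral_mono fun y => ?_
      rw [← ENNReal.ofReal]
      exact (ENNReal.ofReal_le_ofReal (le_abs_self _)).trans (by rw [← Real.enorm_eq_ofReal_abs])
    exact (this.trans_lt hgi.2).ne
  · refine le_trans (lintegral_mono_ae ?_) hg
    filter_upwards [hfin'] with y hy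
    lift F y to NNReal using hy.ne with a
    rw [Real.enorm_eq_ofReal_abs]
    simp only [ENNReal.coe_toReal]
    unfold edl
    rw [← ENNReal.coe_sub, ← ENNReal.coe_sub, ← ENNReal.coe_add, ENNReal.ofReal,
      ENNReal.coe_le_coe, ← NNReal.coe_le_coe, Real.coe_toNNReal _ (abs_nonneg _)]
    push_cast
    rw [NNReal.coe_sub_def, NNReal.coe_sub_def, Real.coe_toNNReal']
    have := a.2
    rcases le_total (g y) 0 with h0 | h0
    · rw [max_eq_right h0, abs_of_nonneg (by linarith [a.2] : (0:ℝ) ≤ (a:ℝ) - g y)]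
      rw [max_eq_left (by simp), max_eq_right (by simp)]
      linarith
    · rw [max_eq_left h0]
      rcases le_total (a:ℝ) (g y) with h1 | h1
      · rw [max_eq_right (by linarith), max_eq_left (by linarith), abs_of_nonpos (by linarith)]
        linarith
      · rw [max_eq_left (by linarith), max_eq_right (by linarith), abs_of_nonneg (by linarith)]
        linarith

section
variable {G Y : Type*} [TopologicalSpace Y] [TopologicalSpace.MetrizableSpace Y]
    [SecondCountableTopology Y] [MeasurableSpace Y] [BorelSpace Y] {μ : Measure Y}
    [IsFiniteMeasure μ]

theorem cont_seq (τ : G → Y → Y) (D : G → Y → NNReal) (hτ : ∀ g, Measurable (τ g))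
    (hD : ∀ g, Measurable (D g))
    (hP : ∀ g (F : Y → ℝ≥0∞), Measurable F → ∫⁻ y, D g y * F (τ g y) ∂μ = ∫⁻ y, F y ∂μ)
    (g₀ : G) (s : ℕ → G)
    (hs : ∀ᵐ y ∂μ, Tendsto (fun n => D (s n) y) atTop (𝓝 (D g₀ y)) ∧
      Tendsto (fun n => τ (s n) y) atTop (𝓝 (τ g₀ y)))
    (F : Y → ℝ≥0∞) (hF : Measurable F) (hfin : ∫⁻ y, F y ∂μ ≠ ∞) :
    Tendsto (fun n => ∫⁻ y, edl (D (s n) y * F (τ (s n) y)) (D g₀ y * F (τ g₀ y)) ∂μ)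
      atTop (𝓝 0) := by
  have hmeas : ∀ g (F : Y → ℝ≥0∞), Measurable F → Measurable fun y => D g y * F (τ g y) := by
    intro g F hF
    exact (measurable_coe_nnreal_ennreal.comp (hD g)).mul (hF.comp (hτ g))
  rw [ENNReal.tendsto_nhds_zero]
  intro ε hε
  have hε3 : ε / 3 ≠ 0 := by simp [hε.ne']
  obtain ⟨F', hF'c, hF'fin, hF'⟩ := approx_cont (μ := μ) F hF hfin hε3
  have hF'm : Measurable (fun y => (F' y : ℝ≥0∞)) := by
    have := hF'c.measurable
    fun_prop
  have key : Tendsto (fun n => ∫⁻ y, edl (D (s n) y * F' (τ (s n) y)) (D g₀ y * F' (τ g₀ y)) ∂μ)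
      atTop (𝓝 0) := by
    refine scheffe (fun n y => D (s n) y * F' (τ (s n) y)) _ (fun n => hmeas _ _ hF'm)
      (hmeas _ _ hF'm) (fun n => ?_) ?_ ?_
    · rw [hP _ _ hF'm, hP _ _ hF'm]
    · rw [hP _ _ hF'm]; exact hF'fin
    · filter_upwards [hs] with y hy
      refine ENNReal.Tendsto.mul (ENNReal.tendsto_coe.2 hy.1) (Or.inr ENNReal.coe_ne_top)
        (ENNReal.tendsto_coe.2 ?_) (Or.inr ENNReal.coe_ne_top)
      exact (hF'c.tendsto _).comp hy.2
  have iso : ∀ g, ∫⁻ y, edl (D g y * F (τ g y)) (D g y * F' (τ g y)) ∂μ ≤ ε / 3 := by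
    intro g
    simp_rw [edl_mul]
    rw [hP g (fun y => edl (F y) (F' y)) (measurable_edl hF hF'm)]
    exact hF'
  filter_upwards [ENNReal.tendsto_nhds_zero.1 key (ε / 3) (pos_iff_ne_zero.2 hε3)] with n hn
  calc ∫⁻ y, edl (D (s n) y * F (τ (s n) y)) (D g₀ y * F (τ g₀ y)) ∂μ
      ≤ ∫⁻ y, (edl (D (s n) y * F (τ (s n) y)) (D (s n) y * F' (τ (s n) y)) +
        (edl (D (s n) y * F' (τ (s n) y)) (D g₀ y * F' (τ g₀ y)) +
        edl (D g₀ y * F (τ g₀ y)) (D g₀ y * F' (τ g₀ y)))) ∂μ := by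
        refine lintegral_mono fun y => ?_
        refine (edl_triangle _ (D (s n) y * F' (τ (s n) y)) _).trans (add_le_add le_rfl ?_)
        rw [edl_comm (D g₀ y * F (τ g₀ y))]
        exact edl_triangle _ _ _
    _ ≤ ε / 3 + (ε / 3 + ε / 3) := by
        rw [lintegral_add_left (measurable_edl (hmeas _ _ hF) (hmeas _ _ hF'm)),
          lintegral_add_left (measurable_edl (hmeas _ _ hF'm) (hmeas _ _ hF'm))]
        exact add_le_add (iso _) (add_le_add hn (iso _))
    _ = ε := by
        rw [← add_assoc]; exact ENNReal.add_thirds ε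

end

/-- diagonal extraction of an almost everywhere convergent subsequence -/
theorem diag_ae {Y : Type*} [MeasurableSpace Y] {μ : Measure Y} (f : ℕ → ℕ → Y → ℂ)
    (f0 : ℕ → Y → ℂ) (h : ∀ k, TendstoInMeasure μ (f k) atTop (f0 k)) :
    ∃ φ : ℕ → ℕ, StrictMono φ ∧ ∀ᵐ y ∂μ, ∀ k, Tendsto (fun n => f k (φ n) y) atTop (𝓝 (f0 k y)) := by
  have h1 : ∀ n : ℕ, ∀ᶠ m in atTop, ∀ k ∈ Finset.range (n + 1),
      μ {y | (2⁻¹ : ℝ≥0∞) ^ n ≤ edist (f k m y) (f0 k y)} ≤ 2⁻¹ ^ n := by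
    intro n
    rw [Filter.eventually_all_finset]
    intro k _
    have hpos : (0 : ℝ≥0∞) < 2⁻¹ ^ n := ENNReal.pow_pos (by simp) n
    exact ENNReal.tendsto_nhds_zero.1 (h k _ hpos) _ hpos
  obtain ⟨φ, hφ, hb⟩ := Filter.extraction_forall_of_eventually' (fun n => Filter.eventually_atTop.1 (h1 n))
  refine ⟨φ, hφ, ?_⟩
  rw [ae_all_iff]
  intro k
  have hsum : ∑' n, μ {y | (2⁻¹ : ℝ≥0∞) ^ (n + k) ≤ edist (f k (φ (n + k)) y) (f0 k y)} ≠ ∞ := by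
    have : ∑' n, μ {y | (2⁻¹ : ℝ≥0∞) ^ (n + k) ≤ edist (f k (φ (n + k)) y) (f0 k y)} ≤
        ∑' n : ℕ, (2⁻¹ : ℝ≥0∞) ^ n := by
      refine ENNReal.tsum_le_tsum fun n => (hb (n + k) k (by simp)).trans ?_
      exact pow_le_pow_right_of_le_one' (by simp) (by omega)
    refine (this.trans_lt ?_).ne
    rw [ENNReal.tsum_geometric]
    simp
  filter_upwards [ae_eventually_notMem hsum] with y hy
  have : Tendsto (fun n => f k (φ (n + k)) y) atTop (𝓝 (f0 k y)) := by
    rw [tendsto_iff_edist_tendsto_0]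
    refine tendsto_of_tendsto_of_tendsto_of_le_of_le' tendsto_const_nhds
      ((ENNReal.tendsto_pow_atTop_nhds_zero_of_lt_one (r := 2⁻¹) (by simp)).comp
        (tendsto_add_atTop_nat k)) (by simp) ?_
    filter_upwards [hy] with n hn
    simp only [not_le] at hn
    exact hn.le
  exact (tendsto_add_atTop_iff_nat (f := fun n => f k (φ n) y) k).1 this

/-- reduction of convergence along an arbitrary filter to sequences -/
theorem tendsto_reduce {G Y : Type*} [MeasurableSpace Y] {μ : Measure Y} (l : Filter G)
    (f : ℕ → G → Y → ℂ) (f0 : ℕ → Y → ℂ) (h : ∀ k, TendstoInMeasure μ (f k) l (f0 k))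
    (Φ : G → ℝ≥0∞)
    (hΦ : ∀ s : ℕ → G, (∀ᵐ y ∂μ, ∀ k, Tendsto (fun n => f k (s n) y) atTop (𝓝 (f0 k y))) →
      Tendsto (fun n => Φ (s n)) atTop (𝓝 0)) :
    Tendsto Φ l (𝓝 0) := by
  set l' : Filter G := ⨅ km : ℕ × ℕ, comap (fun g => μ {y | (2⁻¹ : ℝ≥0∞) ^ km.2 ≤
    edist (f km.1 g y) (f0 km.1 y)}) (𝓝 0) with hl'
  have hle : l ≤ l' := by
    refine le_iInf fun km => ?_
    rw [← Filter.tendsto_iff_comap]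
    exact h _ _ (ENNReal.pow_pos (by simp) _)
  refine Tendsto.mono_left ?_ hle
  have : l'.IsCountablyGenerated := by
    rw [hl']; infer_instance
  refine tendsto_of_seq_tendsto fun s hs => ?_
  refine tendsto_of_subseq_tendsto fun ns hns => ?_
  have hm : ∀ k, TendstoInMeasure μ (fun n => f k (s (ns n))) atTop (f0 k) := by
    intro k ε hε
    obtain ⟨m, hm⟩ : ∃ m : ℕ, (2⁻¹ : ℝ≥0∞) ^ m < ε := by
      have := ENNReal.tendsto_pow_atTop_nhds_zero_of_lt_one (r := 2⁻¹) (by simp)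
      exact ((tendsto_order.1 this).2 ε hε).exists
    have h2 : Tendsto (fun g => μ {y | (2⁻¹ : ℝ≥0∞) ^ m ≤ edist (f k g y) (f0 k y)}) l' (𝓝 0) := by
      rw [Filter.tendsto_iff_comap]
      exact iInf_le (fun km : ℕ × ℕ => comap (fun g => μ {y | (2⁻¹ : ℝ≥0∞) ^ km.2 ≤
        edist (f km.1 g y) (f0 km.1 y)}) (𝓝 0)) (k, m)
    have h3 := (h2.comp hs).comp hns
    refine tendsto_of_tendsto_of_tendsto_of_le_of_le tendsto_const_nhds h3 (fun _ => by simp) ?_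
    intro n
    exact measure_mono fun y hy => hm.le.trans hy
  obtain ⟨φ, hφ, hae⟩ := diag_ae (fun k n => f k (s (ns n))) f0 hm
  exact ⟨φ, hΦ (fun n => s (ns (φ n))) hae⟩

open MeasureTheory ENNReal

open Filter Topology

section
variable {G : Type*} [Group G] [TopologicalSpace G] {Y : Type} [TopologicalSpace Y]
    [TopologicalSpace.MetrizableSpace Y]
    [SecondCountableTopology Y] [MeasurableSpace Y] [BorelSpace Y] [StandardBorelSpace Y]
    {μ : Measure Y} [IsFiniteMeasure μ]

theorem main_lemma {p : ℝ} (hp : 0 < p) (ψ : G → NNReal)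
    (τ : G → Y → Y) (D : G → Y → NNReal) (hτ : ∀ g, Measurable (τ g))
    (hD : ∀ g, Measurable (D g)) (hDpos : ∀ g, ∀ᵐ y ∂μ, D g y ≠ 0)
    (hP : ∀ g (F : Y → ℝ≥0∞), Measurable F → ∫⁻ y, D g y * F (τ g y) ∂μ = ∫⁻ y, F y ∂μ)
    (hone : τ 1 =ᵐ[μ] id) (hmul : ∀ g h, τ (g * h) =ᵐ[μ] τ h ∘ τ g)
    (f : ℕ → G → Y → ℂ)
    (hf : ∀ g₀ k, TendstoInMeasure μ (f k) (𝓝 g₀) (f k g₀))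
    (hcont : ∀ g₀ (s : ℕ → G),
      (∀ᵐ y ∂μ, ∀ k, Tendsto (fun n => f k (s n) y) atTop (𝓝 (f k g₀ y))) →
      ∀ᵐ y ∂μ, Tendsto (fun n => D (s n) y) atTop (𝓝 (D g₀ y)) ∧
        Tendsto (fun n => τ (s n) y) atTop (𝓝 (τ g₀ y)))
    (c : G → Y → ℂ) (hc : ∀ g, MemLp (c g) (ENNReal.ofReal p) μ)
    (hcc : ∀ g₀, Tendsto (fun g => ∫⁻ y, ‖c g y - c g₀ y‖ₑ ^ p ∂μ) (𝓝 g₀) (𝓝 0))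
    (hcoc : ∀ g h, ∀ᵐ y ∂μ, c (g * h) y = c g y + (((D g y : ℝ) ^ p⁻¹ : ℝ) : ℂ) * c h (τ g y))
    (hψ : ∀ g, (ψ g : ℝ≥0∞) = ∫⁻ y, ‖c g y‖ₑ ^ p ∂μ) :
    ∃ (X : Type) (_ : MeasurableSpace X) (μ : Measure X),
      StandardBorelSpace X ∧ SigmaFinite μ ∧
      ∃ (S : NonsingularAction G μ) (c : G → Lp ℂ (ENNReal.ofReal p) μ),
        (∀ g₀ : G, Filter.Tendsto
          (fun g => pPow μ p ((c g : X →ₘ[μ] ℂ) - (c g₀ : X →ₘ[μ] ℂ)))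
          (nhds g₀) (nhds 0)) ∧
        (∀ g h' : G, (c (g * h') : X → ℂ) =ᵐ[μ]
          fun x => (c g : X → ℂ) x +
            ((((μ.map (S.σ g)).rnDeriv μ x).toReal ^ p⁻¹ : ℝ) : ℂ) *
              (c h' : X → ℂ) (S.σ g⁻¹ x)) ∧
        (∀ g : G, (ψ g : ℝ≥0∞) = pPow μ p ((c g : X →ₘ[μ] ℂ))) := by
  have hDm : ∀ g, Measurable fun y => (D g y : ℝ≥0∞) := fun g =>
    measurable_coe_nnreal_ennreal.comp (hD g)
  -- push forward of `F μ` by `τ g⁻¹`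
  have hinv : ∀ g, τ g⁻¹ ∘ τ g =ᵐ[μ] id := by
    intro g
    have h1 := hmul g g⁻¹
    rw [mul_inv_cancel] at h1
    exact h1.symm.trans hone
  have hpush : ∀ g (F : Y → ℝ≥0∞), Measurable F →
      (μ.withDensity F).map (τ g⁻¹) = μ.withDensity (fun y => D g y * F (τ g y)) := by
    intro g F hF
    ext A hA
    rw [Measure.map_apply (hτ _) hA, withDensity_apply _ (hτ _ hA), withDensity_apply _ hA,
      ← lintegral_indicator (hτ _ hA), ← lintegral_indicator hA,
      ← hP g _ (hF.indicator (hτ _ hA))]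
    refine lintegral_congr_ae ?_
    filter_upwards [hinv g] with y hy
    simp only [Function.comp_apply, id] at hy
    by_cases hyA : y ∈ A
    · rw [Set.indicator_of_mem hyA, Set.indicator_of_mem (by simpa [hy] using hyA)]
    · rw [Set.indicator_of_notMem hyA, Set.indicator_of_notMem (by simpa [hy] using hyA), mul_zero]
  have hpush1 : ∀ g, μ.map (τ g⁻¹) = μ.withDensity (fun y => D g y) := by
    intro g
    have := hpush g (fun _ => 1) measurable_const
    simpa using this
  have hqmp : ∀ g, μ.map (τ g) ≪ μ := by
    intro g
    have := hpush1 g⁻¹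
    rw [inv_inv] at this
    rw [this]
    exact withDensity_absolutelyContinuous _ _
  have hqmp' : ∀ g, Measure.QuasiMeasurePreserving (τ g) μ μ := fun g => ⟨hτ g, hqmp g⟩
  have hrn : ∀ g (F : Y → ℝ≥0∞), Measurable F →
      ((μ.withDensity F).map (τ g⁻¹)).rnDeriv μ =ᵐ[μ] (fun y => D g y * F (τ g y)) := by
    intro g F hF
    rw [hpush g F hF]
    exact Measure.rnDeriv_withDensity _ ((hDm g).mul (hF.comp (hτ g)))
  have hrn1 : ∀ g, (μ.map (τ g⁻¹)).rnDeriv μ =ᵐ[μ] (fun y => (D g y : ℝ≥0∞)) := by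
    intro g
    rw [hpush1 g]
    exact Measure.rnDeriv_withDensity _ (hDm g)
  let S : NonsingularAction G μ :=
    { σ := fun g => τ g⁻¹
      measurable := fun g => hτ _
      nonsingular := by
        intro g
        refine ⟨hqmp _, ?_⟩
        rw [hpush1 g]
        refine withDensity_absolutelyContinuous' (hDm g).aemeasurable ?_
        filter_upwards [hDpos g] with y hy
        simpa using hy
      σ_one := by rw [inv_one]; exact hone
      σ_mul := by
        intro g h
        rw [mul_inv_rev]
        exact hmul _ _
      continuous := by
        intro ν hν hνμ g₀
        set F := ν.rnDeriv μ with hFdef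
        have hF : Measurable F := Measure.measurable_rnDeriv _ _
        have hνF : μ.withDensity F = ν := Measure.withDensity_rnDeriv_eq _ _ hνμ
        have hfin : ∫⁻ y, F y ∂μ ≠ ∞ := (Measure.lintegral_rnDeriv_lt_top ν μ).ne
        have hre : ∀ g, ∫⁻ x, ((ν.map (τ g⁻¹)).rnDeriv μ x - (ν.map (τ g₀⁻¹)).rnDeriv μ x)
          + ((ν.map (τ g₀⁻¹)).rnDeriv μ x - (ν.map (τ g⁻¹)).rnDeriv μ x) ∂μ =
          ∫⁻ y, edl (D g y * F (τ g y)) (D g₀ y * F (τ g₀ y)) ∂μ := by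
          intro g
          refine lintegral_congr_ae ?_
          have h1 := hrn g F hF
          have h2 := hrn g₀ F hF
          rw [hνF] at h1 h2
          filter_upwards [h1, h2] with y hy1 hy2
          rw [hy1, hy2]; rfl
        simp_rw [hre]
        refine tendsto_reduce (𝓝 g₀) f (fun k => f k g₀) (hf g₀) _ fun s hs => ?_
        exact cont_seq τ D hτ hD hP g₀ s (hcont g₀ s hs) F hF hfin }
  have hpp : ∀ (u : Y → ℂ) (v : Y →ₘ[μ] ℂ), v =ᵐ[μ] u → pPow μ p v = ∫⁻ y, ‖u y‖ₑ ^ p ∂μ := by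
    intro u v huv
    unfold pPow
    refine lintegral_congr_ae ?_
    filter_upwards [huv] with y hy
    rw [hy]; rfl
  refine ⟨Y, inferInstance, μ, inferInstance, inferInstance, S, fun g => (hc g).toLp, ?_, ?_, ?_⟩
  · intro g₀
    refine (hcc g₀).congr fun g => ?_
    refine (hpp _ _ ?_).symm
    filter_upwards [AEEqFun.coeFn_sub (((hc g).toLp : Lp ℂ _ μ) : Y →ₘ[μ] ℂ)
      (((hc g₀).toLp : Lp ℂ _ μ) : Y →ₘ[μ] ℂ), (hc g).coeFn_toLp, (hc g₀).coeFn_toLp] with y h1 h2 h3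
    rw [h1, Pi.sub_apply, h2, h3]
  · intro g h
    have h4 := (hqmp' g).ae (hc h).coeFn_toLp
    filter_upwards [hcoc g h, (hc g).coeFn_toLp, (hc (g * h)).coeFn_toLp, h4, hrn1 g] with y h1 h2 h3 h4 h5
    change _ = _ + ((((μ.map (τ g⁻¹)).rnDeriv μ y).toReal ^ p⁻¹ : ℝ) : ℂ) *
      ((hc h).toLp : Y → ℂ) (τ g⁻¹⁻¹ y)
    rw [inv_inv, h3, h2, h5, h4, h1]
    rfl
  · intro g
    rw [hψ g]
    exact (hpp _ _ (hc g).coeFn_toLp).symm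
end

open MeasureTheory ENNReal

open Filter Topology

theorem pow_strict {A B q : ℝ} (hA : 0 < A) (hB : 0 < B) (hq : 1 < q) :
    A ^ q + B ^ q < (A + B) ^ q := by
  have e : ∀ C : ℝ, 0 < C → C ^ q = C * C ^ (q - 1) := by
    intro C hC
    rw [← Real.rpow_one_add' hC.le (by linarith)]; congr 1; ring
  rw [e A hA, e B hB, e (A + B) (by linarith)]
  have h1 : A ^ (q - 1) < (A + B) ^ (q - 1) :=
    Real.rpow_lt_rpow hA.le (by linarith) (by linarith)
  have h2 : B ^ (q - 1) < (A + B) ^ (q - 1) :=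
    Real.rpow_lt_rpow hB.le (by linarith) (by linarith)
  nlinarith

theorem pow_strict' {A B q : ℝ} (hA : 0 < A) (hB : 0 < B) (hq0 : 0 < q) (hq : q < 1) :
    (A + B) ^ q < A ^ q + B ^ q := by
  have e : ∀ C : ℝ, 0 < C → C ^ q = C * C ^ (q - 1) := by
    intro C hC
    rw [← Real.rpow_one_add' hC.le (by linarith)]; congr 1; ring
  rw [e A hA, e B hB, e (A + B) (by linarith)]
  have h1 : (A + B) ^ (q - 1) < A ^ (q - 1) :=
    Real.rpow_lt_rpow_of_neg hA (by linarith) (by linarith)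
  have h2 : (A + B) ^ (q - 1) < B ^ (q - 1) :=
    Real.rpow_lt_rpow_of_neg hB (by linarith) (by linarith)
  nlinarith

theorem clarkson_aux (a b : ℂ) (p : ℝ) :
    ∃ S D : ℝ, 0 ≤ S ∧ 0 ≤ D ∧ (S + D) / 2 = ‖a‖ ^ 2 + ‖b‖ ^ 2 ∧ ‖a + b‖ ^ p = S ^ (p / 2) ∧
      ‖a - b‖ ^ p = D ^ (p / 2) := by
  have key : ∀ z : ℂ, ‖z‖ ^ p = (‖z‖ ^ 2) ^ (p / 2) := by
    intro z
    rw [← Real.rpow_natCast, ← Real.rpow_mul (norm_nonneg _)]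
    congr 1; push_cast; ring
  refine ⟨‖a + b‖ ^ 2, ‖a - b‖ ^ 2, by positivity, by positivity, ?_, key _, key _⟩
  have := parallelogram_law_with_norm ℝ a b
  nlinarith

theorem clarkson_gt {a b : ℂ} {p : ℝ} (hp : 2 < p) (ha : a ≠ 0) (hb : b ≠ 0) :
    2 * (‖a‖ ^ p + ‖b‖ ^ p) < ‖a + b‖ ^ p + ‖a - b‖ ^ p := by
  obtain ⟨S, D, hS, hD, hSD, h1, h2⟩ := clarkson_aux a b p
  have key : ∀ z : ℂ, ‖z‖ ^ p = (‖z‖ ^ 2) ^ (p / 2) := by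
    intro z
    rw [← Real.rpow_natCast, ← Real.rpow_mul (norm_nonneg _)]
    congr 1; push_cast; ring
  rw [h1, h2, key a, key b]
  have h3 := pow_strict (A := ‖a‖ ^ 2) (B := ‖b‖ ^ 2) (q := p / 2) (by positivity) (by positivity)
    (by linarith)
  have h4 := (convexOn_rpow (p := p / 2) (by linarith)).2 (Set.mem_Ici.2 hS) (Set.mem_Ici.2 hD)
    (by norm_num : (0 : ℝ) ≤ 1 / 2) (by norm_num : (0 : ℝ) ≤ 1 / 2) (by norm_num)
  simp only [smul_eq_mul] at h4
  have h5 : 1 / 2 * S + 1 / 2 * D = ‖a‖ ^ 2 + ‖b‖ ^ 2 := by linarith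
  rw [h5] at h4
  linarith

theorem clarkson_lt {a b : ℂ} {p : ℝ} (hp0 : 0 < p) (hp : p < 2) (ha : a ≠ 0) (hb : b ≠ 0) :
    ‖a + b‖ ^ p + ‖a - b‖ ^ p < 2 * (‖a‖ ^ p + ‖b‖ ^ p) := by
  obtain ⟨S, D, hS, hD, hSD, h1, h2⟩ := clarkson_aux a b p
  have key : ∀ z : ℂ, ‖z‖ ^ p = (‖z‖ ^ 2) ^ (p / 2) := by
    intro z
    rw [← Real.rpow_natCast, ← Real.rpow_mul (norm_nonneg _)]
    congr 1; push_cast; ring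
  rw [h1, h2, key a, key b]
  have h3 := pow_strict' (A := ‖a‖ ^ 2) (B := ‖b‖ ^ 2) (q := p / 2) (by positivity) (by positivity)
    (by linarith) (by linarith)
  have h4 := (Real.concaveOn_rpow (p := p / 2) (by linarith) (by linarith)).2 (Set.mem_Ici.2 hS) (Set.mem_Ici.2 hD)
    (by norm_num : (0 : ℝ) ≤ 1 / 2) (by norm_num : (0 : ℝ) ≤ 1 / 2) (by norm_num)
  simp only [smul_eq_mul] at h4
  have h5 : 1 / 2 * S + 1 / 2 * D = ‖a‖ ^ 2 + ‖b‖ ^ 2 := by linarith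
  rw [h5] at h4
  linarith

theorem enorm_rpow_eq (a : ℂ) {p : ℝ} (hp : 0 < p) : ‖a‖ₑ ^ p = ENNReal.ofReal (‖a‖ ^ p) := by
  rw [← ofReal_norm, ENNReal.ofReal_rpow_of_nonneg (norm_nonneg _) hp.le]

theorem clarkson_eq {a b : ℂ} {p : ℝ} (hp0 : 0 < p) (h : a = 0 ∨ b = 0) :
    ‖a + b‖ₑ ^ p + ‖a - b‖ₑ ^ p = 2 * (‖a‖ₑ ^ p + ‖b‖ₑ ^ p) := by
  rcases h with rfl | rfl
  · simp [hp0, two_mul]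
  · simp [hp0, two_mul]

theorem clarkson_gt' (a b : ℂ) {p : ℝ} (hp : 2 < p) :
    2 * (‖a‖ₑ ^ p + ‖b‖ₑ ^ p) ≤ ‖a + b‖ₑ ^ p + ‖a - b‖ₑ ^ p ∧
    (2 * (‖a‖ₑ ^ p + ‖b‖ₑ ^ p) = ‖a + b‖ₑ ^ p + ‖a - b‖ₑ ^ p → a = 0 ∨ b = 0) := by
  have hp0 : 0 < p := by linarith
  by_cases h : a = 0 ∨ b = 0
  · exact ⟨(clarkson_eq hp0 h).ge, fun _ => h⟩
  have h' := h
  push Not at h'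
  have := clarkson_gt hp h'.1 h'.2
  have hlt : 2 * (‖a‖ₑ ^ p + ‖b‖ₑ ^ p) < ‖a + b‖ₑ ^ p + ‖a - b‖ₑ ^ p := by
    simp only [enorm_rpow_eq _ hp0]
    rw [← ENNReal.ofReal_add (by positivity) (by positivity),
      ← ENNReal.ofReal_add (by positivity) (by positivity),
      show (2 : ℝ≥0∞) = ENNReal.ofReal 2 by simp, ← ENNReal.ofReal_mul (by norm_num)]
    exact (ENNReal.ofReal_lt_ofReal_iff_of_nonneg (by positivity)).2 this
  exact ⟨hlt.le, fun h => absurd h hlt.ne⟩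

theorem clarkson_lt' (a b : ℂ) {p : ℝ} (hp0 : 0 < p) (hp : p < 2) :
    ‖a + b‖ₑ ^ p + ‖a - b‖ₑ ^ p ≤ 2 * (‖a‖ₑ ^ p + ‖b‖ₑ ^ p) ∧
    (‖a + b‖ₑ ^ p + ‖a - b‖ₑ ^ p = 2 * (‖a‖ₑ ^ p + ‖b‖ₑ ^ p) → a = 0 ∨ b = 0) := by
  by_cases h : a = 0 ∨ b = 0
  · exact ⟨(clarkson_eq hp0 h).le, fun _ => h⟩
  have h' := h
  push Not at h'
  have := clarkson_lt hp0 hp h'.1 h'.2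
  have hlt : ‖a + b‖ₑ ^ p + ‖a - b‖ₑ ^ p < 2 * (‖a‖ₑ ^ p + ‖b‖ₑ ^ p) := by
    simp only [enorm_rpow_eq _ hp0]
    rw [← ENNReal.ofReal_add (by positivity) (by positivity),
      ← ENNReal.ofReal_add (by positivity) (by positivity),
      show (2 : ℝ≥0∞) = ENNReal.ofReal 2 by simp, ← ENNReal.ofReal_mul (by norm_num)]
    exact (ENNReal.ofReal_lt_ofReal_iff_of_nonneg (by positivity)).2 this
  exact ⟨hlt.le, fun h => absurd h hlt.ne⟩

section
variable {X : Type*} [MeasurableSpace X] {μ : Measure X} {p : ℝ}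

theorem eLpNorm_eq_pow (hp : 0 < p) (f : X → ℂ) :
    eLpNorm f (ENNReal.ofReal p) μ = (∫⁻ x, ‖f x‖ₑ ^ p ∂μ) ^ p⁻¹ := by
  rw [eLpNorm_eq_lintegral_rpow_enorm_toReal (by simpa using hp) (by simp),
    ENNReal.toReal_ofReal hp.le, one_div]

theorem memLp_iff_pow (hp : 0 < p) (f : X → ℂ) :
    MemLp f (ENNReal.ofReal p) μ ↔ AEStronglyMeasurable f μ ∧ ∫⁻ x, ‖f x‖ₑ ^ p ∂μ < ∞ := by
  unfold MemLp
  rw [eLpNorm_eq_pow hp]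
  simp only [ENNReal.rpow_lt_top_iff_of_pos (inv_pos.2 hp)]

/-- A function-level model for real-linear isometries of `L_p`. -/
structure FnIso (μ : Measure X) (p : ℝ) (T : (X → ℂ) → X → ℂ) : Prop where
  meas : ∀ f, Measurable (T f)
  mem : ∀ f, MemLp f (ENNReal.ofReal p) μ → MemLp (T f) (ENNReal.ofReal p) μ
  congr : ∀ f g, MemLp f (ENNReal.ofReal p) μ → MemLp g (ENNReal.ofReal p) μ → f =ᵐ[μ] g →
    T f =ᵐ[μ] T g
  add : ∀ f g, MemLp f (ENNReal.ofReal p) μ → MemLp g (ENNReal.ofReal p) μ →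
    T (fun x => f x + g x) =ᵐ[μ] fun x => T f x + T g x
  smul : ∀ (a : ℝ) f, MemLp f (ENNReal.ofReal p) μ →
    T (fun x => a * f x) =ᵐ[μ] fun x => a * T f x
  norm : ∀ f, MemLp f (ENNReal.ofReal p) μ → ∫⁻ x, ‖T f x‖ₑ ^ p ∂μ = ∫⁻ x, ‖f x‖ₑ ^ p ∂μ

structure FnPair (μ : Measure X) (p : ℝ) (T S : (X → ℂ) → X → ℂ) : Prop where
  left : FnIso μ p T
  right : FnIso μ p S
  TS : ∀ f, MemLp f (ENNReal.ofReal p) μ → T (S f) =ᵐ[μ] f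
  ST : ∀ f, MemLp f (ENNReal.ofReal p) μ → S (T f) =ᵐ[μ] f

theorem FnPair.symm {T S : (X → ℂ) → X → ℂ} (h : FnPair μ p T S) : FnPair μ p S T :=
  ⟨h.right, h.left, h.ST, h.TS⟩

variable {T S : (X → ℂ) → X → ℂ}

theorem FnIso.sub (h : FnIso μ p T) (f g : X → ℂ) (hf : MemLp f (ENNReal.ofReal p) μ)
    (hg : MemLp g (ENNReal.ofReal p) μ) :
    T (fun x => f x - g x) =ᵐ[μ] fun x => T f x - T g x := by
  have h1 := h.smul (-1) g hg
  have hg' : MemLp (fun x => ((-1 : ℝ) : ℂ) * g x) (ENNReal.ofReal p) μ := hg.const_mul _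
  have h2 := h.add f _ hf hg'
  have e : (fun x => f x - g x) = fun x => f x + ((-1 : ℝ) : ℂ) * g x := by
    ext x; push_cast; ring
  rw [e]
  filter_upwards [h1, h2] with x h1 h2
  rw [h2, h1]; push_cast; ring

theorem FnIso.disj (hp : 0 < p) (hp2 : p ≠ 2) (h : FnIso μ p T) (f g : X → ℂ)
    (hf : MemLp f (ENNReal.ofReal p) μ) (hg : MemLp g (ENNReal.ofReal p) μ)
    (hfg : ∀ᵐ x ∂μ, f x = 0 ∨ g x = 0) : ∀ᵐ x ∂μ, T f x = 0 ∨ T g x = 0 := by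
  have hfa : MemLp (fun x => f x + g x) (ENNReal.ofReal p) μ := hf.add hg
  have hfs : MemLp (fun x => f x - g x) (ENNReal.ofReal p) μ := hf.sub hg
  have hm := h.meas
  have eA : ∫⁻ x, (‖T f x + T g x‖ₑ ^ p + ‖T f x - T g x‖ₑ ^ p) ∂μ =
      ∫⁻ x, (‖f x + g x‖ₑ ^ p + ‖f x - g x‖ₑ ^ p) ∂μ := by
    rw [lintegral_add_left (by have := hm f; have := hm g; fun_prop), lintegral_add_left'
      ((hfa.1.enorm).pow_const p)]
    congr 1
    · rw [← h.norm _ hfa]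
      refine lintegral_congr_ae ?_
      filter_upwards [h.add f g hf hg] with x hx
      rw [hx]
    · rw [← h.norm _ hfs]
      refine lintegral_congr_ae ?_
      filter_upwards [h.sub f g hf hg] with x hx
      rw [hx]
  have eB : ∫⁻ x, 2 * (‖T f x‖ₑ ^ p + ‖T g x‖ₑ ^ p) ∂μ =
      ∫⁻ x, 2 * (‖f x‖ₑ ^ p + ‖g x‖ₑ ^ p) ∂μ := by
    rw [lintegral_const_mul' _ _ (by simp), lintegral_const_mul' _ _ (by simp),
      lintegral_add_left (by have := hm f; have := hm g; fun_prop), lintegral_add_left'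
      ((hf.1.enorm).pow_const p), h.norm f hf, h.norm g hg]
  have eC : ∫⁻ x, (‖f x + g x‖ₑ ^ p + ‖f x - g x‖ₑ ^ p) ∂μ =
      ∫⁻ x, 2 * (‖f x‖ₑ ^ p + ‖g x‖ₑ ^ p) ∂μ := by
    refine lintegral_congr_ae ?_
    filter_upwards [hfg] with x hx
    exact clarkson_eq hp hx
  have hfin : ∫⁻ x, 2 * (‖f x‖ₑ ^ p + ‖g x‖ₑ ^ p) ∂μ ≠ ∞ := by
    rw [lintegral_const_mul' _ _ (by simp), lintegral_add_left' ((hf.1.enorm).pow_const p)]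
    exact ENNReal.mul_ne_top (by simp) (ENNReal.add_ne_top.2
      ⟨((memLp_iff_pow hp f).1 hf).2.ne, ((memLp_iff_pow hp g).1 hg).2.ne⟩)
  have hmA : Measurable fun x => ‖T f x + T g x‖ₑ ^ p + ‖T f x - T g x‖ₑ ^ p := by
    have := hm f; have := hm g; fun_prop
  have hmB : Measurable fun x => 2 * (‖T f x‖ₑ ^ p + ‖T g x‖ₑ ^ p) := by
    have := hm f; have := hm g; fun_prop
  rcases lt_or_gt_of_ne hp2 with hlt | hgt
  · have := ae_eq_of_ae_le_of_lintegral_le (μ := μ)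
      (f := fun x => ‖T f x + T g x‖ₑ ^ p + ‖T f x - T g x‖ₑ ^ p)
      (g := fun x => 2 * (‖T f x‖ₑ ^ p + ‖T g x‖ₑ ^ p))
      (ae_of_all _ fun x => (clarkson_lt' _ _ hp hlt).1) (by rw [eA, eC]; exact hfin)
      hmB.aemeasurable (by rw [eA, eB, eC])
    filter_upwards [this] with x hx
    exact (clarkson_lt' _ _ hp hlt).2 hx
  · have := ae_eq_of_ae_le_of_lintegral_le (μ := μ)
      (f := fun x => 2 * (‖T f x‖ₑ ^ p + ‖T g x‖ₑ ^ p))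
      (g := fun x => ‖T f x + T g x‖ₑ ^ p + ‖T f x - T g x‖ₑ ^ p)
      (ae_of_all _ fun x => (clarkson_gt' _ _ hgt).1) (by rw [eB]; exact hfin)
      hmA.aemeasurable (by rw [eA, eB, eC])
    filter_upwards [this] with x hx
    exact (clarkson_gt' _ _ hgt).2 hx
end

open MeasureTheory ENNReal

open Filter Topology

section
variable {X : Type*} [MeasurableSpace X] {μ : Measure X} [IsFiniteMeasure μ] {p : ℝ}
variable {T S : (X → ℂ) → X → ℂ}

/-- complex indicator function -/
noncomputable def ind (A : Set X) : X → ℂ := A.indicator (fun _ => 1)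

theorem ind_mem {A : Set X} {x : X} (h : x ∈ A) : ind A x = 1 := Set.indicator_of_mem h _
theorem ind_notMem {A : Set X} {x : X} (h : x ∉ A) : ind A x = 0 := Set.indicator_of_notMem h _
theorem ind_eq_zero {A : Set X} {x : X} : ind A x = 0 ↔ x ∉ A := by
  by_cases h : x ∈ A
  · simp [ind_mem h, h]
  · simp [ind_notMem h, h]

theorem memLp_ind {A : Set X} (hA : MeasurableSet A) : MemLp (ind A) (ENNReal.ofReal p) μ :=
  (memLp_const 1).indicator hA

theorem FnIso.zero (h : FnIso μ p T) : T (fun _ => 0) =ᵐ[μ] fun _ => 0 := by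
  have := h.smul 0 (fun _ => 0) (memLp_const 0)
  simpa using this

theorem FnPair.eq_zero (h : FnPair μ p T S) {f : X → ℂ} (hf : MemLp f (ENNReal.ofReal p) μ)
    (h0 : ∀ᵐ x ∂μ, T f x = 0) : ∀ᵐ x ∂μ, f x = 0 := by
  have h1 := h.right.congr (T f) (fun _ => 0) (h.left.mem _ hf) (memLp_const 0) h0
  filter_upwards [h1, h.ST f hf, h.right.zero] with x a b c
  rw [← b, a, c]

theorem FnPair.disj_iff (h : FnPair μ p T S) (hp : 0 < p) (hp2 : p ≠ 2) {f g : X → ℂ}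
    (hf : MemLp f (ENNReal.ofReal p) μ) (hg : MemLp g (ENNReal.ofReal p) μ) :
    (∀ᵐ x ∂μ, f x = 0 ∨ g x = 0) ↔ ∀ᵐ x ∂μ, T f x = 0 ∨ T g x = 0 := by
  refine ⟨h.left.disj hp hp2 f g hf hg, fun h1 => ?_⟩
  have := h.right.disj hp hp2 _ _ (h.left.mem _ hf) (h.left.mem _ hg) h1
  filter_upwards [this, h.ST f hf, h.ST g hg] with x a b c
  rwa [b, c] at a

theorem FnPair.ne_zero (h : FnPair μ p T S) (hp : 0 < p) (hp2 : p ≠ 2) :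
    ∀ᵐ x ∂μ, T (fun _ => 1) x ≠ 0 := by
  have h1m : MemLp (fun _ : X => (1 : ℂ)) (ENNReal.ofReal p) μ := memLp_const 1
  set B : Set X := {x | T (fun _ => 1) x = 0} with hB
  have hBm : MeasurableSet B := h.left.meas _ (measurableSet_singleton 0)
  have h1 := (h.symm.disj_iff hp hp2 (memLp_ind (p := p) (μ := μ) hBm) (h.left.mem _ h1m)).1 (by
    refine ae_of_all _ fun x => ?_
    by_cases hx : x ∈ B
    · exact Or.inr hx
    · exact Or.inl (ind_notMem hx))
  have h2 := h.symm.eq_zero (memLp_ind (p := p) (μ := μ) hBm) (by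
    filter_upwards [h1, h.ST _ h1m] with x a b
    rcases a with a | a
    · exact a
    · rw [b] at a; exact absurd a one_ne_zero)
  filter_upwards [h2] with x hx
  exact ind_eq_zero.1 hx

/-- the induced set map -/
def Phi (T : (X → ℂ) → X → ℂ) (A : Set X) : Set X := {x | T (ind A) x ≠ 0}

theorem FnIso.measurableSet_Phi (h : FnIso μ p T) (A : Set X) : MeasurableSet (Phi T A) :=
  h.meas _ (measurableSet_singleton (0 : ℂ)).compl

theorem FnIso.split (h : FnIso μ p T) {A : Set X} (hA : MeasurableSet A) {f : X → ℂ}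
    (hf : MemLp f (ENNReal.ofReal p) μ) :
    ∀ᵐ x ∂μ, T f x = T (A.indicator f) x + T (Aᶜ.indicator f) x := by
  have := h.add (A.indicator f) (Aᶜ.indicator f) (hf.indicator hA) (hf.indicator hA.compl)
  have e : (fun x => A.indicator f x + Aᶜ.indicator f x) = f := by
    ext x; exact congrFun (Set.indicator_self_add_compl A f) x
  rwa [e] at this

theorem FnPair.Phi_compl (h : FnPair μ p T S) (hp : 0 < p) (hp2 : p ≠ 2) {A : Set X}
    (hA : MeasurableSet A) : ∀ᵐ x ∂μ, (x ∈ Phi T Aᶜ ↔ x ∉ Phi T A) := by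
  have h1 := (h.disj_iff hp hp2 (memLp_ind (p := p) (μ := μ) hA) (memLp_ind hA.compl)).1 (by
    refine ae_of_all _ fun x => ?_
    by_cases hx : x ∈ A
    · exact Or.inr (ind_notMem (by simpa using hx))
    · exact Or.inl (ind_notMem hx))
  filter_upwards [h1, h.ne_zero hp hp2,
    h.left.split hA (f := fun _ => 1) (memLp_const 1)] with x a b c
  simp only [Phi]
  change T (fun _ => 1) x = T (ind A) x + T (ind Aᶜ) x at c
  constructor
  · intro h1 h2
    rcases a with a | a
    · exact h2 a
    · exact h1 a
  · intro h1 h2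
    have h1 : T (ind A) x = 0 := by by_contra h3; exact h1 h3
    rw [h1, h2] at c
    simp at c; exact b c

theorem FnPair.ind_mul (h : FnPair μ p T S) (hp : 0 < p) (hp2 : p ≠ 2) {A : Set X}
    (hA : MeasurableSet A) {f : X → ℂ} (hf : MemLp f (ENNReal.ofReal p) μ) :
    T (A.indicator f) =ᵐ[μ] (Phi T A).indicator (T f) := by
  have h1 := (h.disj_iff hp hp2 (memLp_ind (p := p) (μ := μ) hA) (hf.indicator hA.compl)).1 (by
    refine ae_of_all _ fun x => ?_
    by_cases hx : x ∈ A
    · exact Or.inr (by simp [hx])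
    · exact Or.inl (ind_notMem hx))
  have h2 := (h.disj_iff hp hp2 (memLp_ind (p := p) (μ := μ) hA.compl) (hf.indicator hA)).1 (by
    refine ae_of_all _ fun x => ?_
    by_cases hx : x ∈ A
    · exact Or.inl (ind_notMem (by simpa using hx))
    · exact Or.inr (by simp [hx]))
  filter_upwards [h1, h2, h.left.split hA hf, h.Phi_compl hp hp2 hA] with x a b c d
  by_cases hx : x ∈ Phi T A
  · rw [Set.indicator_of_mem hx, c]
    have : T (Aᶜ.indicator f) x = 0 := a.resolve_left hx
    rw [this, add_zero]
  · rw [Set.indicator_of_notMem hx]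
    exact b.resolve_left (d.2 hx)

theorem FnPair.Phi_mono (h : FnPair μ p T S) (hp : 0 < p) (hp2 : p ≠ 2) {A B : Set X}
    (hA : MeasurableSet A) (hB : MeasurableSet B) (hAB : A ⊆ B) :
    ∀ᵐ x ∂μ, x ∈ Phi T A → x ∈ Phi T B := by
  have h1 := h.ind_mul hp hp2 hB (memLp_ind (p := p) (μ := μ) hA)
  have e : B.indicator (ind A) = ind A := by
    unfold ind
    rw [Set.indicator_indicator, Set.inter_eq_self_of_subset_right hAB]
  rw [e] at h1
  filter_upwards [h1] with x hx hxA
  by_contra hxB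
  rw [Set.indicator_of_notMem hxB] at hx
  exact hxA hx

theorem FnPair.Phi_iUnion (h : FnPair μ p T S) (hp : 0 < p) (hp2 : p ≠ 2) {A : ℕ → Set X}
    (hA : ∀ n, MeasurableSet (A n)) :
    ∀ᵐ x ∂μ, (x ∈ Phi T (⋃ n, A n) ↔ ∃ n, x ∈ Phi T (A n)) := by
  have hU : MeasurableSet (⋃ n, A n) := MeasurableSet.iUnion hA
  set C : Set X := Phi T (⋃ n, A n) \ ⋃ n, Phi T (A n) with hC
  have hCm : MeasurableSet C := (h.left.measurableSet_Phi _).diff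
    (MeasurableSet.iUnion fun n => h.left.measurableSet_Phi _)
  have hCL : MemLp (ind C) (ENNReal.ofReal p) μ := memLp_ind hCm
  have h1 : ∀ n, ∀ᵐ x ∂μ, S (ind C) x = 0 ∨ ind (A n) x = 0 := by
    intro n
    have := (h.symm.disj_iff hp hp2 hCL (h.left.mem _ (memLp_ind (hA n)))).1 (by
      refine ae_of_all _ fun x => ?_
      by_cases hx : x ∈ C
      · right
        by_contra h3
        exact hx.2 (Set.mem_iUnion.2 ⟨n, h3⟩)
      · exact Or.inl (ind_notMem hx))
    filter_upwards [this, h.ST _ (memLp_ind (hA n))] with x a b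
    rwa [b] at a
  have h2 : ∀ᵐ x ∂μ, S (ind C) x = 0 ∨ ind (⋃ n, A n) x = 0 := by
    filter_upwards [ae_all_iff.2 h1] with x hx
    by_cases h0 : S (ind C) x = 0
    · exact Or.inl h0
    · right
      rw [ind_eq_zero, Set.mem_iUnion]
      rintro ⟨n, hn⟩
      exact ind_eq_zero.1 ((hx n).resolve_left h0) hn
  have h3 := (h.disj_iff hp hp2 (h.right.mem _ hCL) (memLp_ind hU)).1 h2
  have h4 : ∀ᵐ x ∂μ, ∀ n, x ∈ Phi T (A n) → x ∈ Phi T (⋃ n, A n) := ae_all_iff.2 fun n =>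
    h.Phi_mono hp hp2 (hA n) hU (Set.subset_iUnion A n)
  filter_upwards [h3, h4, h.TS _ hCL] with x a b c
  rw [c] at a
  constructor
  · intro hx
    by_contra hn
    rcases a with a | a
    · exact ind_eq_zero.1 a ⟨hx, by simpa using hn⟩
    · exact hx a
  · rintro ⟨n, hn⟩
    exact b n hn

theorem FnPair.Phi_surj (h : FnPair μ p T S) (hp : 0 < p) (hp2 : p ≠ 2) {B : Set X}
    (hB : MeasurableSet B) : ∃ A, MeasurableSet A ∧ ∀ᵐ x ∂μ, (x ∈ Phi T A ↔ x ∈ B) := by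
  have hBL : MemLp (ind B) (ENNReal.ofReal p) μ := memLp_ind hB
  have hBcL : MemLp (ind Bᶜ) (ENNReal.ofReal p) μ := memLp_ind hB.compl
  refine ⟨Phi S B, h.right.measurableSet_Phi B, ?_⟩
  have hAL : MemLp (ind (Phi S B)) (ENNReal.ofReal p) μ := memLp_ind (h.right.measurableSet_Phi B)
  -- `Φ A ⊆ B`
  have h1 := (h.disj_iff hp hp2 hAL (h.right.mem _ hBcL)).1 (by
    filter_upwards [h.symm.Phi_compl hp hp2 hB] with x hx
    by_cases hxA : x ∈ Phi S B
    · right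
      by_contra h3
      exact (hx.1 h3) hxA
    · exact Or.inl (ind_notMem hxA))
  have h2 := h.ind_mul hp hp2 (h.right.measurableSet_Phi B) (h.right.mem _ hBL)
  have e : (Phi S B).indicator (S (ind B)) = S (ind B) := by
    ext x
    by_cases hx : x ∈ Phi S B
    · rw [Set.indicator_of_mem hx]
    · rw [Set.indicator_of_notMem hx]
      by_contra h3
      exact hx (fun h4 => h3 h4.symm)
  rw [e] at h2
  filter_upwards [h1, h2, h.TS _ hBL, h.TS _ hBcL] with x a b c d
  rw [c] at b
  rw [d] at a
  constructor
  · intro hx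
    have := ind_eq_zero.1 (a.resolve_left hx)
    simpa using this
  · intro hx
    by_contra hn
    rw [ind_mem hx, Set.indicator_of_notMem hn] at b
    exact one_ne_zero b

theorem FnPair.setLIntegral_Phi (h : FnPair μ p T S) (hp : 0 < p) (hp2 : p ≠ 2) {A : Set X}
    (hA : MeasurableSet A) {f : X → ℂ} (hf : MemLp f (ENNReal.ofReal p) μ) :
    ∫⁻ x in Phi T A, ‖T f x‖ₑ ^ p ∂μ = ∫⁻ x in A, ‖f x‖ₑ ^ p ∂μ := by
  have key : ∀ (A : Set X) (u : X → ℂ), MeasurableSet A →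
      ∫⁻ x in A, ‖u x‖ₑ ^ p ∂μ = ∫⁻ x, ‖A.indicator u x‖ₑ ^ p ∂μ := by
    intro A u hA
    rw [← lintegral_indicator hA]
    congr 1; ext x
    by_cases hx : x ∈ A
    · simp [hx]
    · simp [hx, hp]
  rw [key _ _ (h.left.measurableSet_Phi A), key _ _ hA, ← h.left.norm _ (hf.indicator hA)]
  refine lintegral_congr_ae ?_
  filter_upwards [h.ind_mul hp hp2 hA hf] with x hx
  rw [hx]

theorem FnPair.norm_const (h : FnPair μ p T S) (hp : 0 < p) (hp2 : p ≠ 2) (z : ℂ) :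
    ∀ᵐ x ∂μ, ‖T (fun _ => z) x‖ = ‖z‖ * ‖T (fun _ => 1) x‖ := by
  have hzL : MemLp (fun _ : X => z) (ENNReal.ofReal p) μ := memLp_const z
  have h1L : MemLp (fun _ : X => (1 : ℂ)) (ENNReal.ofReal p) μ := memLp_const 1
  have hm := h.left.meas
  have h1 : (fun x => ‖T (fun _ => z) x‖ₑ ^ p) =ᵐ[μ]
      fun x => ‖z‖ₑ ^ p * ‖T (fun _ => 1) x‖ₑ ^ p := by
    refine ae_eq_of_forall_setLIntegral_eq_of_sigmaFinite₀
      (by have := hm (fun _ => z); fun_prop) (by have := hm (fun _ => 1); fun_prop) ?_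
    intro B hB _
    obtain ⟨A, hA, hAB⟩ := h.Phi_surj hp hp2 hB
    have hset : Phi T A =ᵐ[μ] B := by
      filter_upwards [hAB] with x hx
      exact propext hx
    rw [← setLIntegral_congr hset, ← setLIntegral_congr hset, h.setLIntegral_Phi hp hp2 hA hzL,
      lintegral_const_mul' _ _ (by
        exact (ENNReal.rpow_lt_top_of_nonneg hp.le (by simp)).ne),
      h.setLIntegral_Phi hp hp2 hA h1L]
    simp
  filter_upwards [h1] with x hx
  rw [← ENNReal.mul_rpow_of_nonneg _ _ hp.le, ← enorm_mul] at hx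
  have := (ENNReal.rpow_left_injective hp.ne') hx
  rw [← ofReal_norm, ← ofReal_norm, ENNReal.ofReal_eq_ofReal_iff (by positivity) (by positivity),
    norm_mul] at this
  exact this

/-- the pointwise real-linear map -/
noncomputable def UU (T : (X → ℂ) → X → ℂ) (x : X) (z : ℂ) : ℂ :=
  (z.re : ℂ) * T (fun _ => 1) x + (z.im : ℂ) * T (fun _ => Complex.I) x

theorem UU_sub (x : X) (z w : ℂ) : UU T x (z - w) = UU T x z - UU T x w := by
  unfold UU; simp; ring

theorem UU_add (x : X) (z w : ℂ) : UU T x (z + w) = UU T x z + UU T x w := by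
  unfold UU; simp; ring

theorem FnIso.const (h : FnIso μ p T) (z : ℂ) : ∀ᵐ x ∂μ, T (fun _ => z) x = UU T x z := by
  have h1L : MemLp (fun _ : X => (1 : ℂ)) (ENNReal.ofReal p) μ := memLp_const 1
  have hIL : MemLp (fun _ : X => Complex.I) (ENNReal.ofReal p) μ := memLp_const _
  have h3 := h.add (fun _ => (z.re : ℂ) * 1) (fun _ => (z.im : ℂ) * Complex.I)
    (memLp_const _) (memLp_const _)
  have e : (fun _ : X => (z.re : ℂ) * 1 + (z.im : ℂ) * Complex.I) = fun _ => z := by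
    ext; rw [mul_one]; exact Complex.re_add_im z
  rw [e] at h3
  filter_upwards [h.smul z.re _ h1L, h.smul z.im _ hIL, h3] with x a b c
  rw [c, a, b]; rfl

theorem sim_aux {a b : ℂ} (h1 : ‖b‖ = ‖a‖) (h2 : ‖a + b‖ ^ 2 = 2 * ‖a‖ ^ 2) :
    b.re ^ 2 + b.im ^ 2 = a.re ^ 2 + a.im ^ 2 ∧ a.re * b.re + a.im * b.im = 0 := by
  have h1' : ‖b‖ ^ 2 = ‖a‖ ^ 2 := by rw [h1]
  rw [← Complex.normSq_eq_norm_sq, ← Complex.normSq_eq_norm_sq, Complex.normSq_apply,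
    Complex.normSq_apply] at h1' h2
  simp only [Complex.add_re, Complex.add_im] at h2
  constructor <;> nlinarith

/-- a.e. conformality relations of the two basic images -/
theorem FnPair.conf (h : FnPair μ p T S) (hp : 0 < p) (hp2 : p ≠ 2) :
    ∀ᵐ x ∂μ, (T (fun _ => Complex.I) x).re ^ 2 + (T (fun _ => Complex.I) x).im ^ 2 =
      (T (fun _ => 1) x).re ^ 2 + (T (fun _ => 1) x).im ^ 2 ∧
      (T (fun _ => 1) x).re * (T (fun _ => Complex.I) x).re +
      (T (fun _ => 1) x).im * (T (fun _ => Complex.I) x).im = 0 := by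
  filter_upwards [h.norm_const hp hp2 Complex.I, h.norm_const hp hp2 (1 + Complex.I),
    h.left.const (1 + Complex.I)] with x a b c
  refine sim_aux (by simpa using a) ?_
  rw [c] at b
  have : ‖(1 + Complex.I : ℂ)‖ ^ 2 = 2 := by
    rw [← Complex.normSq_eq_norm_sq, Complex.normSq_apply]; norm_num
  have e : UU T x (1 + Complex.I) = T (fun _ => 1) x + T (fun _ => Complex.I) x := by
    simp [UU]
  rw [← e, b, mul_pow, this]

theorem FnPair.norm_UU (h : FnPair μ p T S) (hp : 0 < p) (hp2 : p ≠ 2) :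
    ∀ᵐ x ∂μ, ∀ z, ‖UU T x z‖ = ‖z‖ * ‖T (fun _ => 1) x‖ := by
  filter_upwards [h.conf hp hp2] with x hx z
  obtain ⟨h1, h2⟩ := hx
  rw [← abs_of_nonneg (norm_nonneg (UU T x z)), ← abs_of_nonneg (by positivity :
    0 ≤ ‖z‖ * ‖T (fun _ => 1) x‖), ← sq_eq_sq_iff_abs_eq_abs, mul_pow, ← Complex.normSq_eq_norm_sq,
    ← Complex.normSq_eq_norm_sq, ← Complex.normSq_eq_norm_sq, Complex.normSq_apply,
    Complex.normSq_apply, Complex.normSq_apply]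
  simp only [UU, Complex.add_re, Complex.add_im, Complex.re_ofReal_mul, Complex.im_ofReal_mul]
  generalize T (fun _ => 1) x = a at *
  generalize T (fun _ => Complex.I) x = b at *
  linear_combination z.im ^ 2 * h1 + 2 * z.re * z.im * h2
end

open MeasureTheory ENNReal

open Filter Topology

section
variable {μ : Measure (ℕ → Bool)} [IsFiniteMeasure μ] {p : ℝ}
variable {T S : ((ℕ → Bool) → ℂ) → (ℕ → Bool) → ℂ}

/-- coordinate cylinder -/
def cyl (k : ℕ) : Set (ℕ → Bool) := {y | y k = true}

theorem measurableSet_cyl (k : ℕ) : MeasurableSet (cyl k) := by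
  have h : Measurable (fun y : ℕ → Bool => y k) := measurable_pi_apply k
  exact h (measurableSet_singleton true)

open Classical in
/-- the point map induced by `T` -/
noncomputable def tau (T : ((ℕ → Bool) → ℂ) → (ℕ → Bool) → ℂ) (x : ℕ → Bool) : ℕ → Bool :=
  fun k => decide (x ∈ Phi T (cyl k))

theorem tau_apply (x : ℕ → Bool) (k : ℕ) : tau T x k = true ↔ x ∈ Phi T (cyl k) := by
  simp [tau]

theorem FnIso.measurable_tau (h : FnIso μ p T) : Measurable (tau T) := by
  refine measurable_pi_iff.2 fun k => measurable_to_bool ?_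
  have : (fun x => tau T x k) ⁻¹' {true} = Phi T (cyl k) := by
    ext x; exact tau_apply x k
  rw [this]; exact h.measurableSet_Phi _

theorem FnPair.tau_pre (h : FnPair μ p T S) (hp : 0 < p) (hp2 : p ≠ 2) {A : Set (ℕ → Bool)}
    (hA : MeasurableSet A) : ∀ᵐ x ∂μ, (tau T x ∈ A ↔ x ∈ Phi T A) := by
  let m0 : MeasurableSpace (ℕ → Bool) :=
    { MeasurableSet' := fun A => MeasurableSet A ∧ ∀ᵐ x ∂μ, (tau T x ∈ A ↔ x ∈ Phi T A)
      measurableSet_empty := by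
        refine ⟨MeasurableSet.empty, ?_⟩
        filter_upwards [h.left.zero] with x hx
        have : ind (∅ : Set (ℕ → Bool)) = fun _ => 0 := by ext; simp [ind]
        simp [Phi, this, hx]
      measurableSet_compl := by
        rintro A ⟨hA, h1⟩
        refine ⟨hA.compl, ?_⟩
        filter_upwards [h1, h.Phi_compl hp hp2 hA] with x a b
        rw [b, ← a]; rfl
      measurableSet_iUnion := by
        intro f hf
        refine ⟨MeasurableSet.iUnion fun n => (hf n).1, ?_⟩
        filter_upwards [ae_all_iff.2 fun n => (hf n).2,
          h.Phi_iUnion hp hp2 (fun n => (hf n).1)] with x a b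
        rw [b, Set.mem_iUnion]
        exact exists_congr a }
  have hle : (MeasurableSpace.pi : MeasurableSpace (ℕ → Bool)) ≤ m0 := by
    have : @Measurable _ _ m0 MeasurableSpace.pi (id : (ℕ → Bool) → (ℕ → Bool)) := by
      refine measurable_pi_iff.2 fun k => measurable_to_bool ?_
      refine ⟨measurableSet_cyl k, ae_of_all _ fun x => ?_⟩
      exact tau_apply x k
    intro A hA
    exact this hA
  exact (hle A hA).2

theorem FnPair.tau_map (h : FnPair μ p T S) (hp : 0 < p) (hp2 : p ≠ 2) :
    (μ.withDensity fun x => ‖T (fun _ => 1) x‖ₑ ^ p).map (tau T) = μ := by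
  have hm := h.left.measurable_tau
  ext A hA
  rw [Measure.map_apply hm hA, withDensity_apply _ (hm hA)]
  have hset : tau T ⁻¹' A =ᵐ[μ] Phi T A := by
    filter_upwards [h.tau_pre hp hp2 hA] with x hx
    exact propext hx
  rw [setLIntegral_congr hset, h.setLIntegral_Phi hp hp2 hA (memLp_const 1)]
  simp

theorem FnPair.tau_lintegral (h : FnPair μ p T S) (hp : 0 < p) (hp2 : p ≠ 2)
    {F : (ℕ → Bool) → ℝ≥0∞} (hF : Measurable F) :
    ∫⁻ x, ‖T (fun _ => 1) x‖ₑ ^ p * F (tau T x) ∂μ = ∫⁻ x, F x ∂μ := by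
  have hm := h.left.measurable_tau
  have h1 := h.left.meas (fun _ => 1)
  conv_rhs => rw [← h.tau_map hp hp2]
  rw [lintegral_map hF hm]
  exact (lintegral_withDensity_eq_lintegral_mul _ (by fun_prop) (hF.comp hm)).symm

theorem FnPair.tau_qmp (h : FnPair μ p T S) (hp : 0 < p) (hp2 : p ≠ 2) :
    Measure.QuasiMeasurePreserving (tau T) μ μ := by
  have hm := h.left.measurable_tau
  have h1 := h.left.meas (fun _ => 1)
  refine ⟨hm, ?_⟩
  have h2 : μ ≪ μ.withDensity fun x => ‖T (fun _ => 1) x‖ₑ ^ p := by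
    refine withDensity_absolutelyContinuous' (by fun_prop) ?_
    filter_upwards [h.ne_zero hp hp2] with x hx
    simp [hx, hp]
  have := h2.map hm
  rwa [h.tau_map hp hp2] at this

theorem enorm_add_pow_le (a b : ℂ) (hp : 0 < p) :
    ‖a + b‖ₑ ^ p ≤ 2 ^ p * (‖a‖ₑ ^ p + ‖b‖ₑ ^ p) := by
  have h1 : ‖a + b‖ₑ ≤ 2 * max ‖a‖ₑ ‖b‖ₑ := by
    refine (enorm_add_le a b).trans ?_
    rw [two_mul]
    exact add_le_add (le_max_left _ _) (le_max_right _ _)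
  refine (ENNReal.rpow_le_rpow h1 hp.le).trans ?_
  rw [ENNReal.mul_rpow_of_nonneg _ _ hp.le]
  gcongr
  rcases le_total ‖a‖ₑ ‖b‖ₑ with h | h
  · rw [max_eq_right h]; exact le_add_self
  · rw [max_eq_left h]; exact le_self_add

theorem FnPair.rep_simple (h : FnPair μ p T S) (hp : 0 < p) (hp2 : p ≠ 2)
    (s : SimpleFunc (ℕ → Bool) ℂ) : T s =ᵐ[μ] fun x => UU T x (s (tau T x)) := by
  have hL : ∀ s : SimpleFunc (ℕ → Bool) ℂ, MemLp s (ENNReal.ofReal p) μ := fun s =>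
    s.memLp_of_isFiniteMeasure _ _
  induction s using SimpleFunc.induction with
  | const c hA =>
    rename_i A
    have e : ⇑(SimpleFunc.piecewise A hA (SimpleFunc.const _ c) (SimpleFunc.const _ 0)) =
        A.indicator (fun _ => c) := by
      ext x; simp [Set.indicator, Set.piecewise]
    rw [e]
    filter_upwards [h.ind_mul hp hp2 hA (f := fun _ => c) (memLp_const c), h.left.const c,
      h.tau_pre hp hp2 hA] with x a b d
    rw [a]
    by_cases hx : x ∈ Phi T A
    · rw [Set.indicator_of_mem hx, Set.indicator_of_mem (d.2 hx), b]
    · rw [Set.indicator_of_notMem hx, Set.indicator_of_notMem (fun h3 => hx (d.1 h3))]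
      simp [UU]
  | add hd hf hg =>
    rename_i f g
    have := h.left.add f g (hL f) (hL g)
    filter_upwards [this, hf, hg] with x a b c
    change T (fun x => f x + g x) x = UU T x (f _ + g _)
    rw [a, UU_add, b, c]

theorem FnPair.measurable_UU_comp (h : FnPair μ p T S) {f : (ℕ → Bool) → ℂ} (hf : Measurable f) :
    Measurable fun x => UU T x (f (tau T x)) := by
  have hm := h.left.measurable_tau
  have h1 := h.left.meas (fun _ => 1)
  have h2 := h.left.meas (fun _ => Complex.I)
  unfold UU
  fun_prop

theorem FnPair.lintegral_UU (h : FnPair μ p T S) (hp : 0 < p) (hp2 : p ≠ 2)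
    {f : (ℕ → Bool) → ℂ} (hf : Measurable f) :
    ∫⁻ x, ‖UU T x (f (tau T x))‖ₑ ^ p ∂μ = ∫⁻ x, ‖f x‖ₑ ^ p ∂μ := by
  rw [← h.tau_lintegral hp hp2 (F := fun x => ‖f x‖ₑ ^ p) (by fun_prop)]
  refine lintegral_congr_ae ?_
  filter_upwards [h.norm_UU hp hp2] with x hx
  rw [← ofReal_norm, hx, ENNReal.ofReal_mul (norm_nonneg _), ofReal_norm, ofReal_norm,
    ENNReal.mul_rpow_of_nonneg _ _ hp.le, mul_comm]

theorem FnPair.rep (h : FnPair μ p T S) (hp : 0 < p) (hp2 : p ≠ 2)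
    {f : (ℕ → Bool) → ℂ} (hf : MemLp f (ENNReal.ofReal p) μ) :
    T f =ᵐ[μ] fun x => UU T x (f (tau T x)) := by
  -- reduce to measurable
  obtain ⟨f', hf'm, hff'⟩ := hf.aestronglyMeasurable
  have hf'L := hf.ae_eq hff'
  have hf'm := hf'm.measurable
  suffices hs : T f' =ᵐ[μ] fun x => UU T x (f' (tau T x)) by
    filter_upwards [hs, h.left.congr f f' hf hf'L hff', (h.tau_qmp hp hp2).ae_eq_comp hff']
      with x a b c
    rw [b, a]
    exact congrArg _ c.symm
  clear hff' hf
  have hTm := h.left.meas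
  have key : ∫⁻ x, ‖T f' x - UU T x (f' (tau T x))‖ₑ ^ p ∂μ = 0 := by
    refine le_antisymm (ENNReal.le_of_forall_pos_le_add ?_) bot_le
    intro ε hε _
    rw [zero_add]
    -- choose δ
    set δ : ℝ≥0∞ := (ε / (2 ^ p * 2)) ^ p⁻¹ with hδ
    have h2p : (2 : ℝ≥0∞) ^ p ≠ ∞ := (ENNReal.rpow_lt_top_of_nonneg hp.le (by simp)).ne
    have h2p0 : (2 : ℝ≥0∞) ^ p ≠ 0 := by simp
    have hε0 : (ε : ℝ≥0∞) / (2 ^ p * 2) ≠ 0 := by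
      refine (ENNReal.div_pos (by exact_mod_cast hε.ne') ?_).ne'
      exact ENNReal.mul_ne_top h2p (by simp)
    have hδ0 : δ ≠ 0 := by
      rw [hδ, Ne, ENNReal.rpow_eq_zero_iff_of_pos (by positivity)]
      exact hε0
    obtain ⟨s, hs, hsL⟩ := hf'L.exists_simpleFunc_eLpNorm_sub_lt ENNReal.ofReal_ne_top hδ0
    have hs2 : ∫⁻ x, ‖f' x - s x‖ₑ ^ p ∂μ ≤ ε / (2 ^ p * 2) := by
      rw [eLpNorm_eq_pow hp, hδ] at hs
      have := (ENNReal.rpow_lt_rpow_iff (by positivity : 0 < p⁻¹)).1 hs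
      exact this.le
    have hsub : MemLp (fun x => f' x - s x) (ENNReal.ofReal p) μ := hf'L.sub hsL
    have hsm := s.measurable
    have i1 : ∫⁻ x, ‖T f' x - T s x‖ₑ ^ p ∂μ = ∫⁻ x, ‖f' x - s x‖ₑ ^ p ∂μ := by
      rw [← h.left.norm _ hsub]
      refine lintegral_congr_ae ?_
      filter_upwards [h.left.sub f' s hf'L hsL] with x hx
      rw [hx]
    have i2 : ∫⁻ x, ‖T s x - UU T x (f' (tau T x))‖ₑ ^ p ∂μ = ∫⁻ x, ‖f' x - s x‖ₑ ^ p ∂μ := by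
      rw [← h.lintegral_UU hp hp2 (f := fun x => f' x - s x) (by fun_prop)]
      refine lintegral_congr_ae ?_
      filter_upwards [h.rep_simple hp hp2 s] with x hx
      rw [hx, UU_sub, enorm_sub_rev]
    calc ∫⁻ x, ‖T f' x - UU T x (f' (tau T x))‖ₑ ^ p ∂μ
        ≤ ∫⁻ x, 2 ^ p * (‖T f' x - T s x‖ₑ ^ p + ‖T s x - UU T x (f' (tau T x))‖ₑ ^ p) ∂μ := by
          refine lintegral_mono fun x => ?_
          have := enorm_add_pow_le (T f' x - T s x) (T s x - UU T x (f' (tau T x))) hp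
          rwa [sub_add_sub_cancel] at this
      _ = 2 ^ p * (∫⁻ x, ‖f' x - s x‖ₑ ^ p ∂μ + ∫⁻ x, ‖f' x - s x‖ₑ ^ p ∂μ) := by
          have a1 := hTm f'
          have a2 := hTm s
          rw [lintegral_const_mul' _ _ h2p, lintegral_add_left (by fun_prop), i1, i2]
      _ ≤ 2 ^ p * (ε / (2 ^ p * 2) + ε / (2 ^ p * 2)) := by gcongr
      _ = ε := by
          rw [← two_mul, ← mul_assoc]
          exact ENNReal.mul_div_cancel (mul_ne_zero h2p0 (by simp))
            (ENNReal.mul_ne_top h2p (by simp))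
  rw [lintegral_eq_zero_iff (by
    have a1 := hTm f'
    have a2 := h.measurable_UU_comp hf'm
    fun_prop)] at key
  filter_upwards [key] with x hx
  have : ‖T f' x - UU T x (f' (tau T x))‖ₑ = 0 := by
    have hx : ‖T f' x - UU T x (f' (tau T x))‖ₑ ^ p = 0 := hx
    rwa [ENNReal.rpow_eq_zero_iff_of_pos hp] at hx
  rw [enorm_eq_zero, sub_eq_zero] at this
  exact this
end

open MeasureTheory ENNReal

open Filter Topology

/-- real inner product on `ℂ` -/
def ip (k w : ℂ) : ℝ := k.re * w.re + k.im * w.im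

/-- frame map -/
def frm (a b k : ℂ) : ℂ := ⟨ip k a, ip k b⟩

theorem ip_sub (k w z : ℂ) : ip k (w - z) = ip k w - ip k z := by
  simp [ip]; ring

theorem ip_add (k w z : ℂ) : ip k (w + z) = ip k w + ip k z := by
  simp [ip]; ring

/-- orthonormality of a pair -/
def Onb (a b : ℂ) : Prop := a.re ^ 2 + a.im ^ 2 = 1 ∧ b.re ^ 2 + b.im ^ 2 = 1 ∧
  a.re * b.re + a.im * b.im = 0

theorem Onb.perp {a b : ℂ} (h : Onb a b) : a.re ^ 2 + b.re ^ 2 = 1 ∧ a.im ^ 2 + b.im ^ 2 = 1 ∧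
    a.re * a.im + b.re * b.im = 0 := by
  obtain ⟨h1, h2, h3⟩ := h
  -- b = ± (-a.im, a.re)
  set t := a.re * b.im - a.im * b.re with ht
  have e1 : b.re = - t * a.im := by
    rw [ht]; linear_combination (-b.re) * h1 + a.re * h3
  have e2 : b.im = t * a.re := by
    rw [ht]; linear_combination (-b.im) * h1 + a.im * h3
  have ht2 : t ^ 2 = 1 := by
    have : b.re ^ 2 + b.im ^ 2 = t ^ 2 * (a.re ^ 2 + a.im ^ 2) := by rw [e1, e2]; ring
    rw [h2, h1] at this; linarith
  refine ⟨?_, ?_, ?_⟩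
  · rw [e1]; linear_combination h1 + a.im ^ 2 * ht2
  · rw [e2]; linear_combination h1 + a.re ^ 2 * ht2
  · rw [e1, e2]; linear_combination - a.re * a.im * ht2

/-- frame map as a linear map -/
def frmLin (a b : ℂ) : ℂ →ₗ[ℝ] ℂ where
  toFun := frm a b
  map_add' x y := by apply Complex.ext <;> simp [frm, ip] <;> ring
  map_smul' c x := by apply Complex.ext <;> simp [frm, ip] <;> ring

theorem Onb.norm_frm {a b : ℂ} (h : Onb a b) (k : ℂ) : ‖frm a b k‖ = ‖k‖ := by
  obtain ⟨h1, h2, h3⟩ := h.perp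
  have : ‖frm a b k‖ ^ 2 = ‖k‖ ^ 2 := by
    rw [← Complex.normSq_eq_norm_sq, ← Complex.normSq_eq_norm_sq, Complex.normSq_apply,
      Complex.normSq_apply]
    simp only [frm, ip]
    linear_combination k.re ^ 2 * h1 + k.im ^ 2 * h2 + 2 * k.re * k.im * h3
  exact (sq_eq_sq₀ (norm_nonneg _) (norm_nonneg _)).1 this

theorem Onb.measurePreserving {a b : ℂ} (h : Onb a b) :
    MeasurePreserving (frm a b) (volume.restrict (Metric.ball 0 1))
      (volume.restrict (Metric.ball 0 1)) := by
  let L : ℂ →ₗᵢ[ℝ] ℂ := ⟨frmLin a b, h.norm_frm⟩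
  let E : ℂ ≃ₗᵢ[ℝ] ℂ := L.toLinearIsometryEquiv rfl
  have hE : (E : ℂ → ℂ) = frm a b := by
    ext k; rfl
  have h1 : MeasurePreserving (frm a b) (volume : Measure ℂ) volume := hE ▸ E.measurePreserving
  have h2 := h1.restrict_preimage (s := Metric.ball 0 1) measurableSet_ball
  have e : frm a b ⁻¹' Metric.ball 0 1 = Metric.ball 0 1 := by
    ext k; simp [h.norm_frm]
  rwa [e] at h2

/-- normalising constant -/
noncomputable def kC (p : ℝ) : ℝ≥0∞ := ∫⁻ k in Metric.ball (0 : ℂ) 1, ENNReal.ofReal |k.re| ^ p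

/-- rotation invariant measure on `ℂ` -/
noncomputable def kappa (p : ℝ) : Measure ℂ := (kC p)⁻¹ • volume.restrict (Metric.ball 0 1)

theorem kC_ne_top {p : ℝ} (hp : 0 < p) : kC p ≠ ∞ := by
  have : kC p ≤ ∫⁻ k in Metric.ball (0 : ℂ) 1, 1 := by
    refine setLIntegral_mono measurable_const fun k hk => ?_
    refine ENNReal.rpow_le_one ?_ hp.le
    rw [← ENNReal.ofReal_one]
    refine ENNReal.ofReal_le_ofReal ((Complex.abs_re_le_norm k).trans ?_)
    simpa using (mem_ball_zero_iff.1 hk).le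
  refine (this.trans_lt ?_).ne
  simp

theorem kC_ne_zero {p : ℝ} (hp : 0 < p) : kC p ≠ 0 := by
  unfold kC
  have hm : Measurable fun k : ℂ => ENNReal.ofReal |k.re| ^ p := by fun_prop
  refine (((lintegral_pos_iff_support hm)).2 ?_).ne'
  have hs : MeasurableSet (Function.support fun k : ℂ => ENNReal.ofReal |k.re| ^ p) :=
    measurableSet_support hm
  rw [Measure.restrict_apply hs]
  have hsub : Metric.ball (1 / 2 : ℂ) (1 / 2) ⊆
      (Function.support fun k : ℂ => ENNReal.ofReal |k.re| ^ p) ∩ Metric.ball 0 1 := by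
    intro k hk
    rw [Metric.mem_ball, dist_eq_norm] at hk
    constructor
    · have h1 : |(k - 1 / 2).re| < 1 / 2 := (Complex.abs_re_le_norm _).trans_lt hk
      have h2 : 0 < k.re := by
        rw [abs_lt] at h1
        have := h1.1
        simp at this
        linarith
      have h3 : k.re ≠ 0 := h2.ne'
      simp [h3, hp]
    · rw [mem_ball_zero_iff]
      calc ‖k‖ = ‖(k - 1 / 2) + 1 / 2‖ := by simp
        _ ≤ ‖k - 1 / 2‖ + ‖(1 / 2 : ℂ)‖ := norm_add_le _ _
        _ < 1 / 2 + 1 / 2 := by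
          refine add_lt_add_of_lt_of_le hk ?_
          simp
        _ = 1 := by norm_num
  exact (Metric.measure_ball_pos volume _ (by norm_num)).trans_le (measure_mono hsub)

theorem kappa_finite {p : ℝ} (hp : 0 < p) : IsFiniteMeasure (kappa p) := by
  refine ⟨?_⟩
  unfold kappa
  rw [Measure.smul_apply, smul_eq_mul]
  refine ENNReal.mul_lt_top (by simpa using pos_iff_ne_zero.2 (kC_ne_zero hp)) ?_
  simp

theorem Onb.mp_kappa {a b : ℂ} (h : Onb a b) (p : ℝ) :
    MeasurePreserving (frm a b) (kappa p) (kappa p) :=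
  h.measurePreserving.smul_measure _

theorem lintegral_ip {p : ℝ} (hp : 0 < p) (w : ℂ) :
    ∫⁻ k, ‖((ip k w : ℝ) : ℂ)‖ₑ ^ p ∂(kappa p) = ‖w‖ₑ ^ p := by
  have h1 : ∫⁻ k, ENNReal.ofReal |k.re| ^ p ∂(kappa p) = 1 := by
    unfold kappa
    rw [lintegral_smul_measure, smul_eq_mul]
    exact ENNReal.inv_mul_cancel (kC_ne_zero hp) (kC_ne_top hp)
  by_cases hw : w = 0
  · subst hw; simp [ip, hp]
  have hn : ‖w‖ ≠ 0 := by simpa using hw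
  have hsq : w.re ^ 2 + w.im ^ 2 = ‖w‖ ^ 2 := by
    rw [← Complex.normSq_eq_norm_sq, Complex.normSq_apply]; ring
  have ho : Onb ⟨w.re / ‖w‖, w.im / ‖w‖⟩ ⟨-(w.im / ‖w‖), w.re / ‖w‖⟩ := by
    refine ⟨?_, ?_, ?_⟩
    · simp only [div_pow]; rw [← add_div, hsq]; field_simp
    · simp only [neg_sq, div_pow]; rw [← add_div, add_comm, hsq]; field_simp
    · simp only; ring
  have h2 := (ho.mp_kappa p).lintegral_comp (f := fun k => ENNReal.ofReal |k.re| ^ p)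
    (by fun_prop)
  rw [h1] at h2
  have h3 : ∀ k, ‖((ip k w : ℝ) : ℂ)‖ₑ ^ p = ‖w‖ₑ ^ p * ENNReal.ofReal
      |(frm ⟨w.re / ‖w‖, w.im / ‖w‖⟩ ⟨-(w.im / ‖w‖), w.re / ‖w‖⟩ k).re| ^ p := by
    intro k
    rw [← ENNReal.mul_rpow_of_nonneg _ _ hp.le, ← ofReal_norm, ← ofReal_norm,
      ← ENNReal.ofReal_mul (norm_nonneg _)]
    congr 2
    rw [Complex.norm_real, Real.norm_eq_abs]
    nth_rewrite 1 [← abs_of_nonneg (norm_nonneg w)]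
    rw [← abs_mul]
    congr 1
    simp only [frm, ip]
    field_simp
  simp_rw [h3]
  rw [lintegral_const_mul' _ _ (ENNReal.rpow_lt_top_of_nonneg hp.le (by simp)).ne, h2, mul_one]

open MeasureTheory ENNReal

open Filter Topology

section
variable {μ : Measure (ℕ → Bool)} [IsFiniteMeasure μ] {p : ℝ}
variable {T S : ((ℕ → Bool) → ℂ) → (ℕ → Bool) → ℂ}

/-- fibre map -/
noncomputable def kap (T : ((ℕ → Bool) → ℂ) → (ℕ → Bool) → ℂ) (x : ℕ → Bool) (k : ℂ) : ℂ :=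
  frm ⟨(T (fun _ => 1) x).re / ‖T (fun _ => 1) x‖, (T (fun _ => 1) x).im / ‖T (fun _ => 1) x‖⟩
    ⟨(T (fun _ => Complex.I) x).re / ‖T (fun _ => 1) x‖,
      (T (fun _ => Complex.I) x).im / ‖T (fun _ => 1) x‖⟩ k

theorem kap_ip (x : ℕ → Bool) (hx : T (fun _ => 1) x ≠ 0) (k z : ℂ) :
    ‖T (fun _ => 1) x‖ * ip (kap T x k) z = ip k (UU T x z) := by
  have hn : ‖T (fun _ => 1) x‖ ≠ 0 := by simpa using hx
  simp only [kap, frm, ip, UU, Complex.add_re, Complex.add_im, Complex.re_ofReal_mul,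
    Complex.im_ofReal_mul]
  field_simp
  ring

theorem ip_ext {a b : ℂ} (h : ∀ z, ip a z = ip b z) : a = b := by
  have h1 := h 1
  have h2 := h Complex.I
  simp [ip] at h1 h2
  exact Complex.ext h1 h2

theorem kap_eq_of (x : ℕ → Bool) (hx : T (fun _ => 1) x ≠ 0) (k w : ℂ)
    (h : ∀ z, ‖T (fun _ => 1) x‖ * ip w z = ip k (UU T x z)) : kap T x k = w := by
  have hn : ‖T (fun _ => 1) x‖ ≠ 0 := by simpa using hx
  refine ip_ext fun z => ?_
  have := kap_ip x hx k z
  rw [← h z] at this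
  exact mul_left_cancel₀ hn this

theorem FnPair.onb (h : FnPair μ p T S) (hp : 0 < p) (hp2 : p ≠ 2) :
    ∀ᵐ x ∂μ, MeasurePreserving (kap T x) (kappa p) (kappa p) := by
  filter_upwards [h.conf hp hp2, h.ne_zero hp hp2] with x hx hx0
  have hn : ‖T (fun _ => 1) x‖ ≠ 0 := by simpa using hx0
  have hsq : (T (fun _ => 1) x).re ^ 2 + (T (fun _ => 1) x).im ^ 2 = ‖T (fun _ => 1) x‖ ^ 2 := by
    rw [← Complex.normSq_eq_norm_sq, Complex.normSq_apply]; ring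
  refine Onb.mp_kappa ?_ p
  refine ⟨?_, ?_, ?_⟩
  · simp only [div_pow]; rw [← add_div, hsq]; field_simp
  · simp only [div_pow]; rw [← add_div, hx.1, hsq]; field_simp
  · simp only
    rw [div_mul_div_comm, div_mul_div_comm, ← add_div, hx.2, zero_div]

theorem FnIso.measurable_kap (h : FnIso μ p T) :
    Measurable fun y : (ℕ → Bool) × ℂ => kap T y.1 y.2 := by
  have h1 := h.meas (fun _ => 1)
  have h2 := h.meas (fun _ => Complex.I)
  have : (fun y : (ℕ → Bool) × ℂ => kap T y.1 y.2) = fun y =>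
      ((ip y.2 ⟨(T (fun _ => 1) y.1).re / ‖T (fun _ => 1) y.1‖,
        (T (fun _ => 1) y.1).im / ‖T (fun _ => 1) y.1‖⟩ : ℝ) : ℂ) +
      ((ip y.2 ⟨(T (fun _ => Complex.I) y.1).re / ‖T (fun _ => 1) y.1‖,
        (T (fun _ => Complex.I) y.1).im / ‖T (fun _ => 1) y.1‖⟩ : ℝ) : ℂ) * Complex.I := by
    ext y
    apply Complex.ext <;> simp [kap, frm]
  rw [this]
  simp only [ip]
  fun_prop

theorem FnPair.prod_lintegral (h : FnPair μ p T S) (hp : 0 < p) (hp2 : p ≠ 2)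
    {F : (ℕ → Bool) × ℂ → ℝ≥0∞} (hF : Measurable F) :
    ∫⁻ y, ((‖T (fun _ => 1) y.1‖₊ ^ p : NNReal) : ℝ≥0∞) * F (tau T y.1, kap T y.1 y.2)
      ∂(μ.prod (kappa p)) = ∫⁻ y, F y ∂(μ.prod (kappa p)) := by
  have := kappa_finite hp
  have h1 := h.left.meas (fun _ => 1)
  have hm := h.left.measurable_tau
  have hk := h.left.measurable_kap
  have hFc : Measurable fun y : (ℕ → Bool) × ℂ => F (tau T y.1, kap T y.1 y.2) :=
    hF.comp ((hm.comp measurable_fst).prodMk hk)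
  rw [lintegral_prod _ (by fun_prop), lintegral_prod _ hF.aemeasurable,
    ← h.tau_lintegral hp hp2 hF.lintegral_prod_right']
  refine lintegral_congr_ae ?_
  filter_upwards [h.onb hp hp2] with x hx
  rw [lintegral_const_mul' _ _ (by simp), hx.lintegral_comp (f := fun k => F (tau T x, k))
    (hF.comp (measurable_const.prodMk measurable_id))]
  congr 1
  rw [ENNReal.coe_rpow_of_nonneg _ hp.le]; rfl

theorem ae_fst {P : (ℕ → Bool) → Prop} {κ : Measure ℂ} (h : ∀ᵐ x ∂μ, P x) :
    ∀ᵐ y ∂(μ.prod κ), P y.1 :=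
  Measure.quasiMeasurePreserving_fst.ae h
end

open MeasureTheory ENNReal

open Filter Topology

/-- the conclusion of the main theorem -/
def Concl {G : Type*} [Group G] [TopologicalSpace G] (p : ℝ) (ψ : G → NNReal) : Prop :=
    ∃ (X : Type) (_ : MeasurableSpace X) (μ : Measure X),
      StandardBorelSpace X ∧ SigmaFinite μ ∧
      ∃ (S : NonsingularAction G μ) (c : G → Lp ℂ (ENNReal.ofReal p) μ),
        (∀ g₀ : G, Filter.Tendsto
          (fun g => pPow μ p ((c g : X →ₘ[μ] ℂ) - (c g₀ : X →ₘ[μ] ℂ)))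
          (nhds g₀) (nhds 0)) ∧
        (∀ g h' : G, (c (g * h') : X → ℂ) =ᵐ[μ]
          fun x => (c g : X → ℂ) x +
            ((((μ.map (S.σ g)).rnDeriv μ x).toReal ^ p⁻¹ : ℝ) : ℂ) *
              (c h' : X → ℂ) (S.σ g⁻¹ x)) ∧
        (∀ g : G, (ψ g : ℝ≥0∞) = pPow μ p ((c g : X →ₘ[μ] ℂ)))

section
variable {G : Type*} [Group G] [TopologicalSpace G]
variable {μ : Measure (ℕ → Bool)} [IsFiniteMeasure μ] {p : ℝ}
variable {T : G → ((ℕ → Bool) → ℂ) → (ℕ → Bool) → ℂ}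

theorem UU_lin {T : ((ℕ → Bool) → ℂ) → (ℕ → Bool) → ℂ} (x : ℕ → Bool) (a b : ℝ) (z w : ℂ) :
    UU T x (a * z + b * w) = a * UU T x z + b * UU T x w := by
  simp [UU]; ring

theorem group_mul (hp : 0 < p) (hp2 : p ≠ 2) (hT : ∀ g, FnPair μ p (T g) (T g⁻¹))
    (hTm : ∀ g h f, MemLp f (ENNReal.ofReal p) μ → T (g * h) f =ᵐ[μ] T g (T h f)) (g h : G) :
    ∀ᵐ x ∂μ, tau (T (g * h)) x = tau (T h) (tau (T g) x) ∧
      ∀ k, kap (T (g * h)) x k = kap (T h) (tau (T g) x) (kap (T g) x k) := by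
  have e : ∀ f, MemLp f (ENNReal.ofReal p) μ →
      ∀ᵐ x ∂μ, T (g * h) f x = UU (T g) x (T h f (tau (T g) x)) := by
    intro f hf
    filter_upwards [hTm g h f hf, (hT g).rep hp hp2 ((hT h).left.mem f hf)] with x a b
    rw [a, b]
  filter_upwards [e (fun _ => 1) (memLp_const _), e (fun _ => Complex.I) (memLp_const _),
    ae_all_iff.2 fun k => e (ind (cyl k)) (memLp_ind (measurableSet_cyl k)),
    (hT g).norm_UU hp hp2, (hT g).ne_zero hp hp2, (hT (g * h)).ne_zero hp hp2,
    ((hT g).tau_qmp hp hp2).ae ((hT h).ne_zero hp hp2)] with x e1 e2 e3 hn h0 h0' h0''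
  constructor
  · funext k
    rw [Bool.eq_iff_iff, tau_apply, tau_apply]
    simp only [Phi, Set.mem_ofPred_eq]
    rw [e3, not_iff_not, ← norm_eq_zero, hn, mul_eq_zero, norm_eq_zero, norm_eq_zero]
    simp [h0]
  · intro k
    refine kap_eq_of x h0' k _ fun z => ?_
    have hU : UU (T (g * h)) x z = UU (T g) x (UU (T h) (tau (T g) x) z) := by
      conv_lhs => unfold UU
      conv_rhs => arg 3; unfold UU
      rw [e1, e2, UU_lin]
    rw [hU, ← kap_ip x h0, ← kap_ip _ h0'', ← mul_assoc]
    congr 1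
    rw [e1, hn, mul_comm]

theorem group_one (hp : 0 < p) (hp2 : p ≠ 2) (hT : ∀ g, FnPair μ p (T g) (T g⁻¹))
    (hT1 : ∀ f, MemLp f (ENNReal.ofReal p) μ → T 1 f =ᵐ[μ] f) :
    ∀ᵐ x ∂μ, tau (T 1) x = x ∧ ∀ k, kap (T 1) x k = k := by
  filter_upwards [hT1 (fun _ => 1) (memLp_const _), hT1 (fun _ => Complex.I) (memLp_const _),
    ae_all_iff.2 fun k => hT1 (ind (cyl k)) (memLp_ind (measurableSet_cyl k))] with x e1 e2 e3
  constructor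
  · funext k
    rw [Bool.eq_iff_iff, tau_apply]
    simp only [Phi, Set.mem_ofPred_eq]
    rw [e3, Ne, ind_eq_zero, not_not]
    rfl
  · intro k
    refine kap_eq_of x (by rw [e1]; exact one_ne_zero) k _ fun z => ?_
    simp [UU, e1, e2, ip]

/-- test functions -/
noncomputable def tst (T : G → ((ℕ → Bool) → ℂ) → (ℕ → Bool) → ℂ) :
    ℕ → ((ℕ → Bool) → ℂ)
  | 0 => fun _ => 1
  | 1 => fun _ => Complex.I
  | (k + 2) => ind (cyl k)

theorem tst_mem (k : ℕ) : MemLp (tst T k) (ENNReal.ofReal p) μ := by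
  match k with
  | 0 => exact memLp_const _
  | 1 => exact memLp_const _
  | (k + 2) => exact memLp_ind (measurableSet_cyl k)

theorem tau_tendsto (a : ℕ → ℂ) (b : ℕ → ℂ) (a0 b0 : ℂ) (ha : Tendsto a atTop (𝓝 a0))
    (hb : Tendsto b atTop (𝓝 b0)) (hb0 : b0 ≠ 0) (h : ∀ n, a n ≠ 0 → a n = b n)
    (h0 : a0 ≠ 0 → a0 = b0) : ∀ᶠ n in atTop, (a n ≠ 0 ↔ a0 ≠ 0) := by
  by_cases ha0 : a0 = 0
  · subst ha0
    have h1 : Tendsto (fun n => b n - a n) atTop (𝓝 (b0 - 0)) := hb.sub ha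
    have h2 : ∀ᶠ n in atTop, b n - a n ≠ 0 := h1.eventually_ne (by simpa using hb0)
    filter_upwards [h2] with n hn
    simp only [ne_eq, not_true_eq_false, iff_false, not_not]
    by_contra h3
    exact hn (by rw [h n h3, sub_self])
  · filter_upwards [ha.eventually_ne ha0] with n hn
    exact ⟨fun _ => ha0, fun _ => hn⟩

theorem group_case (hp : 0 < p) (hp2 : p ≠ 2) (ψ : G → NNReal)
    (hT : ∀ g, FnPair μ p (T g) (T g⁻¹))
    (hT1 : ∀ f, MemLp f (ENNReal.ofReal p) μ → T 1 f =ᵐ[μ] f)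
    (hTm : ∀ g h f, MemLp f (ENNReal.ofReal p) μ → T (g * h) f =ᵐ[μ] T g (T h f))
    (hTc : ∀ f, MemLp f (ENNReal.ofReal p) μ → ∀ g₀,
      Tendsto (fun g => ∫⁻ x, ‖T g f x - T g₀ f x‖ₑ ^ p ∂μ) (𝓝 g₀) (𝓝 0))
    (c : G → (ℕ → Bool) → ℂ) (hcm : ∀ g, Measurable (c g))
    (hcL : ∀ g, MemLp (c g) (ENNReal.ofReal p) μ)
    (hcc : ∀ g₀, Tendsto (fun g => ∫⁻ x, ‖c g x - c g₀ x‖ₑ ^ p ∂μ) (𝓝 g₀) (𝓝 0))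
    (hcoc : ∀ g h, c (g * h) =ᵐ[μ] fun x => c g x + T g (c h) x)
    (hψ : ∀ g, (ψ g : ℝ≥0∞) = ∫⁻ x, ‖c g x‖ₑ ^ p ∂μ) : Concl p ψ := by
  have := kappa_finite hp
  have hTmeas : ∀ g f, Measurable (T g f) := fun g => (hT g).left.meas
  have hip : ∀ w : (ℕ → Bool) → ℂ, Measurable w →
      Measurable fun y : (ℕ → Bool) × ℂ => ((ip y.2 (w y.1) : ℝ) : ℂ) := by
    intro w hw
    simp only [ip]
    fun_prop
  have hIeq : ∀ w : (ℕ → Bool) → ℂ, Measurable w →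
      ∫⁻ y, ‖((ip y.2 (w y.1) : ℝ) : ℂ)‖ₑ ^ p ∂(μ.prod (kappa p)) = ∫⁻ x, ‖w x‖ₑ ^ p ∂μ := by
    intro w hw
    rw [lintegral_prod _ ((hip w hw).enorm.pow_const p).aemeasurable]
    refine lintegral_congr fun x => ?_
    exact lintegral_ip hp (w x)
  refine main_lemma (Y := (ℕ → Bool) × ℂ) (μ := μ.prod (kappa p)) hp ψ
    (fun g y => (tau (T g) y.1, kap (T g) y.1 y.2))
    (fun g y => ‖T g (fun _ => 1) y.1‖₊ ^ p)
    (fun g => ((hT g).left.measurable_tau.comp measurable_fst).prodMk (hT g).left.measurable_kap)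
    (fun g => ?_) (fun g => ?_) (fun g F hF => (hT g).prod_lintegral hp hp2 hF)
    ?_ (fun g h => ?_) (fun k g y => T g (tst T k) y.1) (fun g₀ k => ?_) (fun g₀ s hs => ?_)
    (fun g y => ((ip y.2 (c g y.1) : ℝ) : ℂ)) (fun g => ?_) (fun g₀ => ?_) (fun g h => ?_)
    (fun g => ?_)
  · have := hTmeas g (fun _ => 1)
    fun_prop
  · filter_upwards [ae_fst ((hT g).ne_zero hp hp2)] with y hy
    simpa [hp.ne'] using hy
  · filter_upwards [ae_fst (group_one hp hp2 hT hT1)] with y hy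
    exact Prod.ext hy.1 (hy.2 _)
  · filter_upwards [ae_fst (group_mul hp hp2 hT hTm g h)] with y hy
    exact Prod.ext hy.1 (hy.2 _)
  · have hL := tst_mem (T := T) (p := p) (μ := μ) k
    refine tendstoInMeasure_of_tendsto_eLpNorm (p := ENNReal.ofReal p) (by simpa using hp)
      (fun g => ((hTmeas g _).comp measurable_fst).aestronglyMeasurable)
      ((hTmeas _ _).comp measurable_fst).aestronglyMeasurable ?_
    have e : ∀ g, eLpNorm ((fun y : (ℕ → Bool) × ℂ => T g (tst T k) y.1) -
        fun y => T g₀ (tst T k) y.1) (ENNReal.ofReal p) (μ.prod (kappa p)) =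
        ((∫⁻ x, ‖T g (tst T k) x - T g₀ (tst T k) x‖ₑ ^ p ∂μ) * kappa p Set.univ) ^ p⁻¹ := by
      intro g
      rw [eLpNorm_eq_pow hp]
      congr 1
      have m1 := hTmeas g (tst T k)
      have m2 := hTmeas g₀ (tst T k)
      simp only [Pi.sub_apply]
      rw [lintegral_prod _ (by fun_prop)]
      simp only [lintegral_const]
      rw [lintegral_mul_const' _ _ (measure_ne_top _ _)]
    simp only [e]
    have h1 := ENNReal.Tendsto.mul_const (hTc _ hL g₀) (b := kappa p Set.univ)
      (Or.inr (measure_ne_top _ _))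
    rw [zero_mul] at h1
    have h2 := h1.ennrpow_const p⁻¹
    rwa [ENNReal.zero_rpow_of_pos (by positivity)] at h2
  · have hne : ∀ g, ∀ᵐ x ∂μ, ∀ k, T g (ind (cyl k)) x ≠ 0 →
        T g (ind (cyl k)) x = T g (fun _ => 1) x := by
      intro g
      refine ae_all_iff.2 fun k => ?_
      filter_upwards [(hT g).ind_mul hp hp2 (measurableSet_cyl k)
        (f := fun _ => 1) (memLp_const _)] with x hx h0
      change T g (ind (cyl k)) x = _ at hx
      rw [hx, Set.indicator_of_mem h0]
    filter_upwards [hs, ae_fst (hne g₀), ae_fst (ae_all_iff.2 fun n => hne (s n)),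
      ae_fst ((hT g₀).ne_zero hp hp2)] with y h1 h2 h3 h4
    have t1 : Tendsto (fun n => T (s n) (fun _ => 1) y.1) atTop (𝓝 (T g₀ (fun _ => 1) y.1)) := h1 0
    have tI : Tendsto (fun n => T (s n) (fun _ => Complex.I) y.1) atTop
      (𝓝 (T g₀ (fun _ => Complex.I) y.1)) := h1 1
    have hn0 : ‖T g₀ (fun _ => 1) y.1‖ ≠ 0 := by simpa using h4
    refine ⟨?_, ?_⟩
    · have h5 := t1.nnnorm
      exact ((NNReal.continuous_rpow_const hp.le).tendsto _).comp h5
    · refine Tendsto.prodMk_nhds ?_ ?_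
      · refine tendsto_pi_nhds.2 fun k => ?_
        refine tendsto_nhds_of_eventually_eq ?_
        have h6 := tau_tendsto _ _ _ _ (h1 (k + 2)) t1 h4 (fun n => h3 n k) (h2 k)
        filter_upwards [h6] with n hn
        rw [Bool.eq_iff_iff, tau_apply, tau_apply]
        exact hn
      · have r1 : Tendsto (fun n => (T (s n) (fun _ => 1) y.1).re) atTop _ :=
          (Complex.continuous_re.tendsto _).comp t1
        have i1 : Tendsto (fun n => (T (s n) (fun _ => 1) y.1).im) atTop _ :=
          (Complex.continuous_im.tendsto _).comp t1
        have r2 : Tendsto (fun n => (T (s n) (fun _ => Complex.I) y.1).re) atTop _ :=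
          (Complex.continuous_re.tendsto _).comp tI
        have i2 : Tendsto (fun n => (T (s n) (fun _ => Complex.I) y.1).im) atTop _ :=
          (Complex.continuous_im.tendsto _).comp tI
        have nn := t1.norm
        have hk : ∀ g, kap (T g) y.1 y.2 =
          (((y.2.re * ((T g (fun _ => 1) y.1).re / ‖T g (fun _ => 1) y.1‖) +
            y.2.im * ((T g (fun _ => 1) y.1).im / ‖T g (fun _ => 1) y.1‖) : ℝ) : ℂ) +
          ((y.2.re * ((T g (fun _ => Complex.I) y.1).re / ‖T g (fun _ => 1) y.1‖) +
            y.2.im * ((T g (fun _ => Complex.I) y.1).im / ‖T g (fun _ => 1) y.1‖) : ℝ) : ℂ)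
            * Complex.I) := by
          intro g
          apply Complex.ext <;> simp [kap, frm, ip]
        simp only [hk]
        refine Tendsto.add ((Complex.continuous_ofReal.tendsto _).comp ?_)
          (Tendsto.mul_const _ ((Complex.continuous_ofReal.tendsto _).comp ?_))
        · exact ((r1.div nn hn0).const_mul _).add ((i1.div nn hn0).const_mul _)
        · exact ((r2.div nn hn0).const_mul _).add ((i2.div nn hn0).const_mul _)
  · rw [memLp_iff_pow hp, hIeq _ (hcm g)]
    exact ⟨(hip _ (hcm g)).aestronglyMeasurable, ((memLp_iff_pow hp _).1 (hcL g)).2⟩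
  · refine (hcc g₀).congr fun g => ?_
    have h1 := hcm g
    have h2 := hcm g₀
    rw [← hIeq (fun x => c g x - c g₀ x) (by fun_prop)]
    refine lintegral_congr fun y => ?_
    rw [ip_sub]; push_cast; rfl
  · have h1 : ∀ᵐ x ∂μ, c (g * h) x = c g x + UU (T g) x (c h (tau (T g) x)) := by
      filter_upwards [hcoc g h, (hT g).rep hp hp2 (hcL h)] with x a b
      rw [a, b]
    filter_upwards [ae_fst h1, ae_fst ((hT g).ne_zero hp hp2)] with y hy hy0
    rw [hy, ip_add, ← kap_ip _ hy0]
    have e : (((‖T g (fun _ => 1) y.1‖₊ ^ p : NNReal) : ℝ) ^ p⁻¹ : ℝ) =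
        ‖T g (fun _ => 1) y.1‖ := by
      rw [NNReal.coe_rpow, coe_nnnorm, Real.rpow_rpow_inv (norm_nonneg _) hp.ne']
    rw [e]
    push_cast; rfl
  · rw [hIeq _ (hcm g)]; exact hψ g
end

open MeasureTheory ENNReal

open Filter Topology

section
variable {G : Type*} [Group G] [TopologicalSpace G]
variable {X : Type*} [MeasurableSpace X] {μ : Measure X} {p : ℝ}

/-- the linear part of an affine action -/
noncomputable def AffineIsometricAction.lin (α : AffineIsometricAction G μ p) (g : G)
    (v : Lp ℂ (ENNReal.ofReal p) μ) : Lp ℂ (ENNReal.ofReal p) μ := α.act g v - α.act g 0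

variable (α : AffineIsometricAction G μ p)

theorem AffineIsometricAction.lin_smul (g : G) (t : ℝ) (v : Lp ℂ (ENNReal.ofReal p) μ) :
    α.lin g (t • v) = t • α.lin g v := by
  have h := α.affine g t v 0
  rw [smul_zero, add_zero] at h
  unfold AffineIsometricAction.lin
  rw [h, sub_smul, one_smul, smul_sub]
  abel

theorem AffineIsometricAction.lin_add (g : G) (v w : Lp ℂ (ENNReal.ofReal p) μ) :
    α.lin g (v + w) = α.lin g v + α.lin g w := by
  have h := α.affine g (1 / 2) ((2 : ℝ) • v) ((2 : ℝ) • w)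
  have e1 : ((1 / 2 : ℝ) • (2 : ℝ) • v + (1 - 1 / 2 : ℝ) • (2 : ℝ) • w) = v + w := by
    rw [smul_smul, smul_smul]; norm_num
  rw [e1] at h
  have h1 := α.lin_smul g 2 v
  have h2 := α.lin_smul g 2 w
  unfold AffineIsometricAction.lin at *
  rw [sub_eq_iff_eq_add] at h1 h2
  rw [h, h1, h2]
  simp only [smul_add, smul_smul]
  norm_num
  have : ((1 / 2 : ℝ) • α.act g 0 + (1 / 2 : ℝ) • α.act g 0) = α.act g 0 := by
    rw [← add_smul]; norm_num
  calc _ = α.act g v - α.act g 0 + (α.act g w - α.act g 0) +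
      (((1 / 2 : ℝ) • α.act g 0 + (1 / 2 : ℝ) • α.act g 0) - α.act g 0) := by abel
    _ = _ := by rw [this]; abel

theorem AffineIsometricAction.lin_sub (g : G) (v w : Lp ℂ (ENNReal.ofReal p) μ) :
    α.lin g (v - w) = α.lin g v - α.lin g w := by
  have h := α.lin_add g (v - w) w
  rw [sub_add_cancel] at h
  rw [h, add_sub_cancel_right]

theorem AffineIsometricAction.lin_one (v : Lp ℂ (ENNReal.ofReal p) μ) : α.lin 1 v = v := by
  unfold AffineIsometricAction.lin
  rw [α.act_one, α.act_one, sub_zero]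

theorem AffineIsometricAction.lin_mul (g h : G) (v : Lp ℂ (ENNReal.ofReal p) μ) :
    α.lin (g * h) v = α.lin g (α.lin h v) := by
  have : α.lin h v = α.act h v - α.act h 0 := rfl
  rw [this, α.lin_sub]
  unfold AffineIsometricAction.lin
  rw [α.act_mul, α.act_mul]
  abel

theorem AffineIsometricAction.coc (g h : G) :
    α.act (g * h) 0 = α.act g 0 + α.lin g (α.act h 0) := by
  unfold AffineIsometricAction.lin
  rw [α.act_mul]
  abel

theorem pPow_eq (v : X →ₘ[μ] ℂ) : pPow μ p v = ∫⁻ x, ‖v x‖ₑ ^ p ∂μ := rfl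

theorem AffineIsometricAction.lin_norm (g : G) (v : Lp ℂ (ENNReal.ofReal p) μ) :
    ∫⁻ x, ‖α.lin g v x‖ₑ ^ p ∂μ = ∫⁻ x, ‖v x‖ₑ ^ p ∂μ := by
  have h := α.isometry g v 0
  rw [← AddSubgroup.coe_sub, ← AddSubgroup.coe_sub, sub_zero] at h
  exact h

theorem pPow_add_le (hp : 0 < p) (v w : Lp ℂ (ENNReal.ofReal p) μ) :
    ∫⁻ x, ‖(v + w : Lp ℂ (ENNReal.ofReal p) μ) x‖ₑ ^ p ∂μ ≤
      2 ^ p * (∫⁻ x, ‖v x‖ₑ ^ p ∂μ + ∫⁻ x, ‖w x‖ₑ ^ p ∂μ) := by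
  have m1 := (Lp.stronglyMeasurable v).measurable
  have m2 := (Lp.stronglyMeasurable w).measurable
  rw [← lintegral_add_left (by fun_prop), ← lintegral_const_mul' _ _
    (ENNReal.rpow_lt_top_of_nonneg hp.le (by simp)).ne]
  refine lintegral_mono_ae ?_
  filter_upwards [Lp.coeFn_add v w] with x hx
  rw [hx]
  exact enorm_add_pow_le _ _ hp

theorem pPow_neg (v : Lp ℂ (ENNReal.ofReal p) μ) :
    ∫⁻ x, ‖(-v : Lp ℂ (ENNReal.ofReal p) μ) x‖ₑ ^ p ∂μ = ∫⁻ x, ‖v x‖ₑ ^ p ∂μ := by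
  refine lintegral_congr_ae ?_
  filter_upwards [Lp.coeFn_neg v] with x hx
  rw [hx, Pi.neg_apply, enorm_neg]

theorem AffineIsometricAction.lin_cont (hp : 0 < p) (v : Lp ℂ (ENNReal.ofReal p) μ) (g₀ : G) :
    Tendsto (fun g => ∫⁻ x, ‖(α.lin g v - α.lin g₀ v : Lp ℂ (ENNReal.ofReal p) μ) x‖ₑ ^ p ∂μ)
      (𝓝 g₀) (𝓝 0) := by
  have h1 := α.continuous v g₀
  have h2 := α.continuous 0 g₀
  have h3 := ENNReal.Tendsto.const_mul (h1.add h2) (a := 2 ^ p)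
    (Or.inr (ENNReal.rpow_lt_top_of_nonneg hp.le (by simp)).ne)
  rw [add_zero, mul_zero] at h3
  refine tendsto_of_tendsto_of_tendsto_of_le_of_le tendsto_const_nhds h3 (fun _ => bot_le) ?_
  intro g
  have e : α.lin g v - α.lin g₀ v = (α.act g v - α.act g₀ v) + -(α.act g 0 - α.act g₀ 0) := by
    unfold AffineIsometricAction.lin; abel
  simp only
  rw [e]
  refine (pPow_add_le hp _ _).trans ?_
  rw [pPow_neg]
  rfl
end

open MeasureTheory ENNReal

open Filter Topology

/-- transfer of `L_p` spaces -/
structure Transfer {X : Type*} [MeasurableSpace X] (μ : Measure X) (p : ℝ)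
    (m : Measure (ℕ → Bool)) (J : ((ℕ → Bool) → ℂ) → X → ℂ) (K : (X → ℂ) → (ℕ → Bool) → ℂ) :
    Prop where
  Kmeas : ∀ u, Measurable u → Measurable (K u)
  Jmem : ∀ f, MemLp f (ENNReal.ofReal p) m → MemLp (J f) (ENNReal.ofReal p) μ
  JK : ∀ u, J (K u) = u
  KJ : ∀ f, K (J f) =ᵐ[m] f
  Jae : ∀ f f', f =ᵐ[m] f' → J f =ᵐ[μ] J f'
  Kae : ∀ u u', u =ᵐ[μ] u' → K u =ᵐ[m] K u'
  Jadd : ∀ f f', J (fun x => f x + f' x) = fun x => J f x + J f' x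
  Jsmul : ∀ (a : ℝ) f, J (fun x => a * f x) = fun x => a * J f x
  Kadd : ∀ u u', K (fun x => u x + u' x) =ᵐ[m] fun x => K u x + K u' x
  Ksmul : ∀ (a : ℝ) u, K (fun x => a * u x) =ᵐ[m] fun x => a * K u x
  Jnorm : ∀ f, ∫⁻ x, ‖J f x‖ₑ ^ p ∂μ = ∫⁻ x, ‖f x‖ₑ ^ p ∂m

theorem exists_transfer {X : Type*} [MeasurableSpace X] [StandardBorelSpace X] (μ : Measure X)
    [SigmaFinite μ] {p : ℝ} (hp : 0 < p) :
    ∃ m J K, IsFiniteMeasure m ∧ Transfer μ p m J K := by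
  obtain ⟨d, hd0, hdm, hdi⟩ := exists_pos_lintegral_lt_of_sigmaFinite μ (ε := 1) one_ne_zero
  obtain ⟨φ, hφm, hφi⟩ := MeasurableSpace.measurable_injection_nat_bool_of_countablySeparated X
  have hφ := hφm.measurableEmbedding hφi
  have hdm' : Measurable fun x => (d x : ℝ≥0∞) := by fun_prop
  set m : Measure (ℕ → Bool) := (μ.withDensity fun x => d x).map φ with hm
  set w : X → ℝ := fun x => (d x : ℝ) ^ p⁻¹ with hw
  have hw0 : ∀ x, (w x : ℂ) ≠ 0 := by
    intro x
    have : 0 < w x := Real.rpow_pos_of_pos (hd0 x) _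
    exact_mod_cast this.ne'
  have hwm : Measurable w := by fun_prop
  have hae : ∀ {P : (ℕ → Bool) → Prop}, (∀ᵐ y ∂m, P y) ↔ ∀ᵐ x ∂μ, P (φ x) := by
    intro P
    rw [hm, hφ.ae_map_iff, ae_withDensity_iff hdm']
    refine eventually_congr (ae_of_all _ fun x => ?_)
    simp [(hd0 x).ne']
  have hKφ : ∀ (u : X → ℂ) x, Function.extend φ (fun x => (w x : ℂ)⁻¹ * u x) 0 (φ x) =
      (w x : ℂ)⁻¹ * u x := fun u x => hφi.extend_apply _ _ _
  have hnorm : ∀ f : (ℕ → Bool) → ℂ,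
      ∫⁻ x, ‖(w x : ℂ) * f (φ x)‖ₑ ^ p ∂μ = ∫⁻ x, ‖f x‖ₑ ^ p ∂m := by
    intro f
    rw [hm, hφ.lintegral_map, lintegral_withDensity_eq_lintegral_mul_non_measurable _ hdm'
      (ae_of_all _ fun x => by simp)]
    refine lintegral_congr fun x => ?_
    rw [enorm_mul, ENNReal.mul_rpow_of_nonneg _ _ hp.le, Pi.mul_apply]
    congr 1
    rw [enorm_rpow_eq _ hp, Complex.norm_real, Real.norm_of_nonneg (by positivity), hw]
    simp only
    rw [Real.rpow_inv_rpow (by positivity) hp.ne', ENNReal.ofReal_coe_nnreal]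
  refine ⟨m, fun f x => (w x : ℂ) * f (φ x),
    fun u => Function.extend φ (fun x => (w x : ℂ)⁻¹ * u x) 0, ?_, ?_⟩
  · rw [hm]
    have : IsFiniteMeasure (μ.withDensity fun x => (d x : ℝ≥0∞)) :=
      isFiniteMeasure_withDensity (hdi.trans ENNReal.one_lt_top).ne
    infer_instance
  · refine ⟨?_, ?_, ?_, ?_, ?_, ?_, ?_, ?_, ?_, ?_, hnorm⟩
    · intro u hu
      exact hφ.measurable_extend (by fun_prop) measurable_const
    · intro f hf
      rw [memLp_iff_pow hp] at hf ⊢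
      rw [hnorm]
      refine ⟨?_, hf.2⟩
      obtain ⟨f', hf', hff'⟩ := hf.1
      have h2 := hae.1 hff'
      refine ⟨fun x => (w x : ℂ) * f' (φ x), ?_, ?_⟩
      · have := hf'.measurable
        exact Measurable.stronglyMeasurable (by fun_prop)
      · filter_upwards [h2] with x hx
        rw [hx]
    · intro u
      funext x
      rw [hKφ, mul_inv_cancel_left₀ (hw0 x)]
    · intro f
      refine hae.2 (ae_of_all _ fun x => ?_)
      rw [hKφ, inv_mul_cancel_left₀ (hw0 x)]
    · intro f f' h
      filter_upwards [hae.1 h] with x hx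
      rw [hx]
    · intro u u' h
      refine hae.2 ?_
      filter_upwards [h] with x hx
      rw [hKφ, hKφ, hx]
    · intro f f'
      funext x; ring
    · intro a f
      funext x; ring
    · intro u u'
      refine hae.2 (ae_of_all _ fun x => ?_)
      simp only
      rw [hKφ, hKφ, hKφ]; ring
    · intro a u
      refine hae.2 (ae_of_all _ fun x => ?_)
      simp only
      rw [hKφ, hKφ]; ring

section
variable {G : Type*} [Group G] [TopologicalSpace G]
variable {X : Type*} [MeasurableSpace X] {μ : Measure X} {p : ℝ}
variable {m : Measure (ℕ → Bool)} {J : ((ℕ → Bool) → ℂ) → X → ℂ} {K : (X → ℂ) → (ℕ → Bool) → ℂ}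

theorem Transfer.Knorm (t : Transfer μ p m J K) (u : X → ℂ) :
    ∫⁻ x, ‖K u x‖ₑ ^ p ∂m = ∫⁻ x, ‖u x‖ₑ ^ p ∂μ := by
  rw [← t.Jnorm, t.JK]

theorem Transfer.Kmem (t : Transfer μ p m J K) (hp : 0 < p) (v : Lp ℂ (ENNReal.ofReal p) μ) :
    MemLp (K v) (ENNReal.ofReal p) m := by
  rw [memLp_iff_pow hp, t.Knorm]
  exact ⟨(t.Kmeas _ (Lp.stronglyMeasurable v).measurable).aestronglyMeasurable,
    ((memLp_iff_pow hp _).1 (Lp.memLp v)).2⟩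

theorem Transfer.Ksub (t : Transfer μ p m J K) (u u' : X → ℂ) :
    K (fun x => u x - u' x) =ᵐ[m] fun x => K u x - K u' x := by
  have e : (fun x => u x - u' x) = fun x => u x + ((-1 : ℝ) : ℂ) * u' x := by
    ext x; push_cast; ring
  rw [e]
  filter_upwards [t.Kadd u (fun x => ((-1 : ℝ) : ℂ) * u' x), t.Ksmul (-1) u'] with x a b
  rw [a, b]; push_cast; ring

open Classical in
/-- transported function-level operator -/
noncomputable def Transfer.op (t : Transfer μ p m J K)
    (L : Lp ℂ (ENNReal.ofReal p) μ → Lp ℂ (ENNReal.ofReal p) μ)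
    (f : (ℕ → Bool) → ℂ) : (ℕ → Bool) → ℂ :=
  if h : MemLp f (ENNReal.ofReal p) m then K (L ((t.Jmem f h).toLp (J f))) else 0

theorem Transfer.op_of (t : Transfer μ p m J K)
    (L : Lp ℂ (ENNReal.ofReal p) μ → Lp ℂ (ENNReal.ofReal p) μ)
    {f : (ℕ → Bool) → ℂ} (h : MemLp f (ENNReal.ofReal p) m) :
    t.op L f = K (L ((t.Jmem f h).toLp (J f))) := dif_pos h

theorem Transfer.op_iso (t : Transfer μ p m J K) (hp : 0 < p)
    (L : Lp ℂ (ENNReal.ofReal p) μ → Lp ℂ (ENNReal.ofReal p) μ)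
    (hadd : ∀ v w, L (v + w) = L v + L w) (hsmul : ∀ (a : ℝ) v, L (a • v) = a • L v)
    (hnorm : ∀ v, ∫⁻ x, ‖L v x‖ₑ ^ p ∂μ = ∫⁻ x, ‖v x‖ₑ ^ p ∂μ) : FnIso m p (t.op L) where
  meas f := by
    by_cases h : MemLp f (ENNReal.ofReal p) m
    · rw [t.op_of L h]
      exact t.Kmeas _ (Lp.stronglyMeasurable _).measurable
    · rw [Transfer.op, dif_neg h]
      exact measurable_const
  mem f h := by
    rw [t.op_of L h]; exact t.Kmem hp _
  congr f g hf hg hfg := by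
    rw [t.op_of L hf, t.op_of L hg,
      MemLp.toLp_congr (t.Jmem f hf) (t.Jmem g hg) (t.Jae _ _ hfg)]
  add f g hf hg := by
    have hfg : MemLp (fun x => f x + g x) (ENNReal.ofReal p) m := hf.add hg
    rw [t.op_of L hf, t.op_of L hg, t.op_of L hfg]
    have e : (t.Jmem _ hfg).toLp (J fun x => f x + g x) =
        (t.Jmem f hf).toLp (J f) + (t.Jmem g hg).toLp (J g) := by
      rw [← MemLp.toLp_add]
      exact MemLp.toLp_congr _ _ (by rw [t.Jadd]; rfl)
    rw [e, hadd]
    exact (t.Kae _ _ (Lp.coeFn_add _ _)).trans (t.Kadd _ _)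
  smul a f hf := by
    have hfa : MemLp (fun x => (a : ℂ) * f x) (ENNReal.ofReal p) m := hf.const_mul _
    rw [t.op_of L hf, t.op_of L hfa]
    have e : (t.Jmem _ hfa).toLp (J fun x => (a : ℂ) * f x) =
        a • (t.Jmem f hf).toLp (J f) := by
      rw [← MemLp.toLp_const_smul]
      refine MemLp.toLp_congr _ _ ?_
      rw [t.Jsmul]
      exact ae_of_all _ fun x => (Complex.real_smul).symm
    rw [e, hsmul]
    refine (t.Kae _ (fun x => (a : ℂ) * _) ?_).trans (t.Ksmul a _)
    filter_upwards [Lp.coeFn_smul a (L ((t.Jmem f hf).toLp (J f)))] with x hx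
    rw [hx, Pi.smul_apply, Complex.real_smul]
  norm f hf := by
    rw [t.op_of L hf, t.Knorm, hnorm, ← t.Jnorm]
    refine lintegral_congr_ae ?_
    filter_upwards [(t.Jmem f hf).coeFn_toLp] with x hx
    rw [hx]

theorem Transfer.op_comp (t : Transfer μ p m J K) (hp : 0 < p)
    (L L' : Lp ℂ (ENNReal.ofReal p) μ → Lp ℂ (ENNReal.ofReal p) μ)
    {f : (ℕ → Bool) → ℂ} (h : MemLp f (ENNReal.ofReal p) m) :
    t.op L (t.op L' f) = t.op (L ∘ L') f := by
  rw [t.op_of L' h, t.op_of (L ∘ L') h, t.op_of L (t.Kmem hp _)]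
  congr 3
  rw [Function.comp_apply]
  congr 1
  have : ∀ (u : X → ℂ) (v : Lp ℂ (ENNReal.ofReal p) μ) (hu : MemLp u (ENNReal.ofReal p) μ),
      u = v → hu.toLp u = v := by
    intro u v hu e
    subst e
    exact Lp.toLp_coeFn v hu
  exact this _ _ _ (t.JK _)

theorem Transfer.op_K (t : Transfer μ p m J K) (hp : 0 < p)
    (L : Lp ℂ (ENNReal.ofReal p) μ → Lp ℂ (ENNReal.ofReal p) μ)
    (v : Lp ℂ (ENNReal.ofReal p) μ) : t.op L (K v) = K (L v) := by
  rw [t.op_of L (t.Kmem hp _)]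
  congr 3
  have : ∀ (u : X → ℂ) (v : Lp ℂ (ENNReal.ofReal p) μ) (hu : MemLp u (ENNReal.ofReal p) μ),
      u = v → hu.toLp u = v := by
    intro u v hu e
    subst e
    exact Lp.toLp_coeFn v hu
  exact congrArg L (this _ _ _ (t.JK _))

theorem Transfer.op_id (t : Transfer μ p m J K)
    {f : (ℕ → Bool) → ℂ} (h : MemLp f (ENNReal.ofReal p) m) : t.op id f =ᵐ[m] f := by
  rw [t.op_of id h]
  exact (t.Kae _ _ (t.Jmem f h).coeFn_toLp).trans (t.KJ f)

theorem case_ne_two [StandardBorelSpace X] [SigmaFinite μ] (hp : 0 < p) (hp2 : p ≠ 2)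
    (ψ : G → NNReal) (α : AffineIsometricAction G μ p)
    (hψ : ∀ g : G, (ψ g : ℝ≥0∞) = pPow μ p ((α.act g 0 : X →ₘ[μ] ℂ))) : Concl p ψ := by
  obtain ⟨m, J, K, hm, t⟩ := exists_transfer μ hp
  have hiso : ∀ g, FnIso m p (t.op (α.lin g)) := fun g =>
    t.op_iso hp _ (α.lin_add g) (α.lin_smul g) (α.lin_norm g)
  have h1 : ∀ f, MemLp f (ENNReal.ofReal p) m → t.op (α.lin 1) f =ᵐ[m] f := by
    intro f hf
    have : α.lin 1 = id := funext α.lin_one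
    rw [this]; exact t.op_id hf
  have hmul : ∀ g h f, MemLp f (ENNReal.ofReal p) m →
      t.op (α.lin (g * h)) f =ᵐ[m] t.op (α.lin g) (t.op (α.lin h) f) := by
    intro g h f hf
    rw [t.op_comp hp _ _ hf]
    have : α.lin (g * h) = α.lin g ∘ α.lin h := funext (α.lin_mul g h)
    rw [this]
  have hdiff : ∀ v w : Lp ℂ (ENNReal.ofReal p) μ, ∫⁻ x, ‖K v x - K w x‖ₑ ^ p ∂m =
      ∫⁻ x, ‖(v - w : Lp ℂ (ENNReal.ofReal p) μ) x‖ₑ ^ p ∂μ := by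
    intro v w
    rw [← t.Knorm]
    refine lintegral_congr_ae ?_
    filter_upwards [t.Kae _ _ (Lp.coeFn_sub v w), t.Ksub v w] with x a b
    rw [a, ← b]; rfl
  refine group_case (T := fun g => t.op (α.lin g)) hp hp2 ψ (fun g => ?_) h1 hmul ?_
    (fun g => K (α.act g 0)) (fun g => t.Kmeas _ (Lp.stronglyMeasurable _).measurable)
    (fun g => t.Kmem hp _) (fun g₀ => ?_) (fun g h => ?_) (fun g => ?_)
  · refine ⟨hiso g, hiso _, fun f hf => ?_, fun f hf => ?_⟩
    · refine (hmul g g⁻¹ f hf).symm.trans ?_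
      rw [mul_inv_cancel]; exact h1 f hf
    · refine (hmul g⁻¹ g f hf).symm.trans ?_
      rw [inv_mul_cancel]; exact h1 f hf
  · intro f hf g₀
    refine (α.lin_cont hp ((t.Jmem f hf).toLp (J f)) g₀).congr fun g => ?_
    rw [t.op_of _ hf, t.op_of _ hf, hdiff]
  · refine (α.continuous 0 g₀).congr fun g => ?_
    rw [hdiff]; rfl
  · rw [t.op_K hp, α.coc]
    exact (t.Kae _ _ (Lp.coeFn_add _ _)).trans (t.Kadd _ _)
  · rw [hψ, t.Knorm]; rfl
end

open MeasureTheory ENNReal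

open Filter Topology

section
variable {ι : Type} 

/-- standard Gaussian product measure -/
noncomputable def gam (ι : Type) : Measure (ι → ℝ) :=
  Measure.infinitePi (fun _ : ι => ProbabilityTheory.gaussianReal 0 1)

instance : IsProbabilityMeasure (gam ι) := by unfold gam; infer_instance

theorem gam_eval (i : ι) : MeasurePreserving (fun x : ι → ℝ => x i) (gam ι)
    (ProbabilityTheory.gaussianReal 0 1) :=
  measurePreserving_eval_infinitePi (fun _ : ι => ProbabilityTheory.gaussianReal 0 1) i

theorem gam_indep : ProbabilityTheory.iIndepFun (fun (i : ι) (x : ι → ℝ) => x i) (gam ι) :=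
  ProbabilityTheory.iIndepFun_infinitePi (X := fun (_ : ι) (x : ℝ) => x) (fun _ => measurable_id)

theorem gam_memLp (i : ι) : MemLp (fun x : ι → ℝ => x i) 2 (gam ι) :=
  (ProbabilityTheory.memLp_id_gaussianReal 2).comp_measurePreserving (gam_eval i)

/-- coordinates -/
noncomputable def gX (i : ι) : Lp ℝ 2 (gam ι) := (gam_memLp i).toLp _

theorem gX_coe (i : ι) : gX i =ᵐ[gam ι] fun x => x i := (gam_memLp i).coeFn_toLp

theorem gX_orthonormal : Orthonormal ℝ (gX : ι → Lp ℝ 2 (gam ι)) := by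
  classical
  rw [orthonormal_iff_ite]
  intro i j
  rw [L2.inner_def]
  have e : ∫ a, inner ℝ (gX i a) (gX j a) ∂(gam ι) = ∫ a, a i * a j ∂(gam ι) := by
    refine integral_congr_ae ?_
    filter_upwards [gX_coe i, gX_coe j] with a h1 h2
    rw [h1, h2]; simp [mul_comm]
  rw [e]
  split_ifs with h
  · subst h
    have h2 : ∫ a, a i * a i ∂(gam ι) = ∫ y, y * y ∂(ProbabilityTheory.gaussianReal 0 1) := by
      rw [← (gam_eval i).map_eq, integral_map (gam_eval i).measurable.aemeasurable]
      exact (measurable_id.mul measurable_id).aestronglyMeasurable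
    rw [h2]
    have h3 := ProbabilityTheory.variance_id_gaussianReal (μ := 0) (v := 1)
    rw [ProbabilityTheory.variance_eq_integral measurable_id.aemeasurable] at h3
    simpa [pow_two] using h3
  · have h1 := (gam_indep.indepFun h).integral_fun_mul_eq_mul_integral 
      (measurable_pi_apply i).aestronglyMeasurable (measurable_pi_apply j).aestronglyMeasurable
    rw [h1]
    have h2 : ∫ a, a i ∂(gam ι) = ∫ y, y ∂(ProbabilityTheory.gaussianReal 0 1) := by
      rw [← (gam_eval i).map_eq, integral_map (gam_eval i).measurable.aemeasurable]
      exact measurable_id.aestronglyMeasurable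
    rw [h2]; simp

theorem gam_char_sum (s : Finset ι) (a : ι → ℝ) :
    ∫ x, Complex.exp ((∑ i ∈ s, a i * x i : ℝ) * Complex.I) ∂(gam ι) =
      Complex.exp (-((∑ i ∈ s, (a i) ^ 2 : ℝ) / 2)) := by
  have h1 : ProbabilityTheory.iIndepFun (fun (i : s) (x : ι → ℝ) => x i) (gam ι) :=
    gam_indep.precomp Subtype.val_injective
  have h2 := h1.integral_fun_prod_comp
    (f := fun (i : s) (y : ℝ) => Complex.exp ((a i * y : ℝ) * Complex.I))
    (fun i => (measurable_pi_apply (i : ι)).aemeasurable)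
    (fun i => by
      refine Continuous.aestronglyMeasurable ?_
      fun_prop)
  have h3 : ∀ i : ι, ∫ x, Complex.exp ((a i * x i : ℝ) * Complex.I) ∂(gam ι) =
      Complex.exp (-((a i : ℂ) ^ 2 / 2)) := by
    intro i
    have e : ∫ x, Complex.exp ((a i * x i : ℝ) * Complex.I) ∂(gam ι) =
        ∫ y : ℝ, Complex.exp ((a i * y : ℝ) * Complex.I) ∂(ProbabilityTheory.gaussianReal 0 1) := by
      rw [← (gam_eval i).map_eq, integral_map (gam_eval i).measurable.aemeasurable]
      refine Continuous.aestronglyMeasurable ?_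
      fun_prop
    rw [e]
    have h4 := ProbabilityTheory.charFun_gaussianReal (μ := 0) (v := 1) (a i)
    rw [charFun_apply_real] at h4
    simpa using h4
  have e1 : ∀ x : ι → ℝ, Complex.exp ((∑ i ∈ s, a i * x i : ℝ) * Complex.I) =
      ∏ i : s, Complex.exp ((a i * x i : ℝ) * Complex.I) := by
    intro x
    rw [← Complex.exp_sum, ← Finset.sum_mul, Finset.sum_coe_sort s
      (fun i => ((a i * x i : ℝ) : ℂ)), Complex.ofReal_sum]
  simp_rw [e1]
  rw [h2]
  simp_rw [h3]
  rw [← Complex.exp_sum, Finset.sum_coe_sort s (fun i => (-((a i : ℂ) ^ 2 / 2)))]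
  congr 1
  push_cast
  rw [Finset.sum_neg_distrib, Finset.sum_div]

variable {E : Type*} [NormedAddCommGroup E] [InnerProductSpace ℝ E]

/-- Gaussian isometry -/
noncomputable def gW (b : HilbertBasis ι ℝ E) : E →ₗᵢ[ℝ] Lp ℝ 2 (gam ι) :=
  (gX_orthonormal (ι := ι)).orthogonalFamily.linearIsometry.comp b.repr.toLinearIsometry

theorem gW_basis (b : HilbertBasis ι ℝ E) (i : ι) : gW b (b i) = gX i := by
  classical
  simp [gW, HilbertBasis.repr_self]

theorem gW_sum (b : HilbertBasis ι ℝ E) (s : Finset ι) (a : ι → ℝ) :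
    gW b (∑ i ∈ s, a i • b i) =ᵐ[gam ι] fun x => ∑ i ∈ s, a i * x i := by
  classical
  rw [map_sum]
  simp_rw [map_smul, gW_basis]
  induction s using Finset.induction_on with
  | empty =>
    simp only [Finset.sum_empty]
    exact Lp.coeFn_zero _ _ _
  | insert i s hi ih =>
    rw [Finset.sum_insert hi]
    filter_upwards [Lp.coeFn_add (a i • gX i) (∑ i ∈ s, a i • gX i), ih, gX_coe i,
      Lp.coeFn_smul (a i) (gX i)] with x h1 h2 h3 h4
    rw [h1, Pi.add_apply, h4, Pi.smul_apply, h3, h2, Finset.sum_insert hi, smul_eq_mul]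

theorem norm_cexp_sub (a b : ℝ) :
    ‖Complex.exp (a * Complex.I) - Complex.exp (b * Complex.I)‖ ≤ ‖a - b‖ := by
  have h := Real.norm_exp_I_mul_ofReal_sub_one_le (x := a - b)
  have : Complex.exp (a * Complex.I) - Complex.exp (b * Complex.I) =
      Complex.exp (b * Complex.I) * (Complex.exp (Complex.I * (a - b : ℝ)) - 1) := by
    rw [mul_sub, ← Complex.exp_add, mul_one]
    congr 2
    push_cast; ring
  rw [this, norm_mul, Complex.norm_exp_ofReal_mul_I, one_mul]
  exact h

theorem cexp_integrable (f : Lp ℝ 2 (gam ι)) :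
    Integrable (fun x => Complex.exp (f x * Complex.I)) (gam ι) := by
  refine Integrable.mono' (integrable_const (1 : ℝ)) ?_ (ae_of_all _ fun x => ?_)
  · have := (Lp.stronglyMeasurable f).measurable
    exact Measurable.aestronglyMeasurable (by fun_prop)
  · rw [Complex.norm_exp_ofReal_mul_I]

theorem cexp_cont : Continuous fun f : Lp ℝ 2 (gam ι) =>
    ∫ x, Complex.exp (f x * Complex.I) ∂(gam ι) := by
  refine (LipschitzWith.of_dist_le_mul (K := 1) fun f g => ?_).continuous
  rw [dist_eq_norm, ← integral_sub (cexp_integrable f) (cexp_integrable g), dist_eq_norm,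
    NNReal.coe_one, one_mul, Lp.norm_def]
  refine (norm_integral_le_integral_norm _).trans ?_
  have hI : MemLp (f - g : Lp ℝ 2 (gam ι)) 1 (gam ι) :=
    (Lp.memLp (f - g)).mono_exponent (by norm_num)
  calc _ ≤ ∫ x, ‖(f - g : Lp ℝ 2 (gam ι)) x‖ ∂(gam ι) := by
        refine integral_mono_ae ((cexp_integrable f).sub (cexp_integrable g)).norm
          (memLp_one_iff_integrable.1 hI).norm ?_
        filter_upwards [Lp.coeFn_sub f g] with x hx
        rw [hx]
        exact norm_cexp_sub _ _
    _ = (eLpNorm (f - g : Lp ℝ 2 (gam ι)) 1 (gam ι)).toReal := by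
        rw [eLpNorm_one_eq_lintegral_enorm, integral_norm_eq_lintegral_enorm hI.1]
    _ ≤ _ := by
        refine ENNReal.toReal_mono (Lp.eLpNorm_ne_top _) ?_
        exact eLpNorm_le_eLpNorm_of_exponent_le (by norm_num) (Lp.aestronglyMeasurable _)

theorem gW_char (b : HilbertBasis ι ℝ E) (v : E) :
    ∫ x, Complex.exp (gW b v x * Complex.I) ∂(gam ι) = Complex.exp (-((‖v‖ ^ 2 : ℝ) / 2)) := by
  have h1 := b.hasSum_repr v
  have h2 := ((cexp_cont.comp (gW b).continuous).tendsto v).comp h1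
  have h3 : Continuous fun v : E => Complex.exp (-((‖v‖ ^ 2 : ℝ) / 2)) := by fun_prop
  have h4 := (h3.tendsto v).comp h1
  refine tendsto_nhds_unique h2 (h4.congr fun s => ?_)
  simp only [Function.comp]
  have e : ∫ x, Complex.exp (gW b (∑ i ∈ s, b.repr v i • b i) x * Complex.I) ∂(gam ι) =
      ∫ x, Complex.exp ((∑ i ∈ s, b.repr v i * x i : ℝ) * Complex.I) ∂(gam ι) := by
    refine integral_congr_ae ?_
    filter_upwards [gW_sum b s (fun i => b.repr v i)] with x hx
    rw [hx]
  rw [e, gam_char_sum s (fun i => b.repr v i), ← real_inner_self_eq_norm_sq,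
    b.orthonormal.inner_sum]
  simp [pow_two]

end

open MeasureTheory ENNReal

open Filter Topology

section
variable {ι : Type} {E : Type*} [NormedAddCommGroup E] [InnerProductSpace ℝ E]

/-- the transformation induced by an isometry -/
noncomputable def gT (b : HilbertBasis ι ℝ E) (O : E →ₗᵢ[ℝ] E) (x : ι → ℝ) : ι → ℝ :=
  fun i => gW b (O (b i)) x

theorem gT_meas (b : HilbertBasis ι ℝ E) (O : E →ₗᵢ[ℝ] E) : Measurable (gT b O) :=
  measurable_pi_lambda _ fun i => (Lp.stronglyMeasurable (gW b (O (b i)))).measurable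

theorem gW_sum' (b : HilbertBasis ι ℝ E) (O : E →ₗᵢ[ℝ] E) {κ : Type} (s : Finset κ) (a : κ → ℝ)
    (j : κ → ι) :
    gW b (O (∑ i ∈ s, a i • b (j i))) =ᵐ[gam ι] fun x => ∑ i ∈ s, a i * gW b (O (b (j i))) x := by
  classical
  rw [map_sum, map_sum]
  simp_rw [map_smul]
  induction s using Finset.induction_on with
  | empty =>
    simp only [Finset.sum_empty]
    exact Lp.coeFn_zero _ _ _
  | insert i s hi ih =>
    rw [Finset.sum_insert hi]
    filter_upwards [Lp.coeFn_add (a i • gW b (O (b (j i)))) (∑ i ∈ s, a i • gW b (O (b (j i)))), ih,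
      Lp.coeFn_smul (a i) (gW b (O (b (j i))))] with x h1 h2 h4
    rw [h1, Pi.add_apply, h4, Pi.smul_apply, h2, Finset.sum_insert hi, smul_eq_mul]

theorem gT_mp (b : HilbertBasis ι ℝ E) (O : E →ₗᵢ[ℝ] E) :
    MeasurePreserving (gT b O) (gam ι) (gam ι) := by
  refine ⟨gT_meas b O, ?_⟩
  have hg : IsProjectiveLimit (gam ι) (fun I : Finset ι =>
      (Measure.pi fun _ : I => ProbabilityTheory.gaussianReal 0 1 : Measure (I → ℝ))) :=
    (Measure.isProjectiveLimit_infinitePi fun _ : ι => ProbabilityTheory.gaussianReal 0 1)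
  refine IsProjectiveLimit.unique ?_ hg
  intro I
  have mr : Measurable (I.restrict : (ι → ℝ) → (I → ℝ)) := Finset.measurable_restrict I
  have : IsFiniteMeasure ((gam ι).map (gT b O)) := by infer_instance
  refine charFun_eq_pi_iff.1 fun t => ?_
  have mt : Measurable (WithLp.toLp 2 : (I → ℝ) → PiLp 2 (fun _ : I => ℝ)) := by fun_prop
  rw [Measure.map_map mr (gT_meas b O), Measure.map_map mt (mr.comp (gT_meas b O)),
    charFun_apply, integral_map (mt.comp (mr.comp (gT_meas b O))).aemeasurable
      (Continuous.aestronglyMeasurable (by fun_prop))]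
  simp_rw [ProbabilityTheory.charFun_gaussianReal]
  have e := gW_char b (O (∑ i : I, t i • b (i : ι)))
  have e' := (b.orthonormal.comp (Subtype.val : I → ι) Subtype.val_injective).inner_sum
    (fun i => t i) (fun i => t i) Finset.univ
  simp only [Function.comp] at e'
  rw [LinearIsometry.norm_map, ← real_inner_self_eq_norm_sq, e'] at e
  rw [← Complex.exp_sum]
  convert e using 1
  · refine integral_congr_ae ?_
    filter_upwards [gW_sum' b O Finset.univ (fun i : I => t i) (fun i : I => (i : ι))] with x hx
    rw [hx]
    simp [gT, PiLp.inner_apply, Function.comp]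
  · simp [pow_two, Finset.sum_div]

theorem gW_comp (b : HilbertBasis ι ℝ E) (O : E →ₗᵢ[ℝ] E) (v : E) :
    (fun x => gW b v (gT b O x)) =ᵐ[gam ι] gW b (O v) := by
  have h : (Lp.compMeasurePreservingₗᵢ ℝ (gT b O) (gT_mp b O)).comp (gW b) = (gW b).comp O := by
    apply LinearIsometry.toContinuousLinearMap_injective
    refine ContinuousLinearMap.ext_on (s := Set.range b) ?_ ?_
    · have := b.dense_span
      rw [Submodule.dense_iff_topologicalClosure_eq_top, this]
    · rintro _ ⟨i, rfl⟩
      apply Lp.ext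
      refine (Lp.coeFn_compMeasurePreserving (gW b (b i)) (gT_mp b O)).trans ?_
      have h1 := (gT_mp b O).quasiMeasurePreserving.ae (gX_coe i)
      rw [gW_basis]
      filter_upwards [h1] with x hx
      simp only [Function.comp]
      rw [hx]
      rfl
  have h2 := congrArg (fun L => L v) h
  have h3 := Lp.coeFn_compMeasurePreserving (gW b v) (gT_mp b O)
  exact h3.symm.trans (Eq.eventuallyEq (congrArg (fun f : Lp ℝ 2 (gam ι) => (f : (ι → ℝ) → ℝ)) h2))

theorem hb_countable [SecondCountableTopology E] (b : HilbertBasis ι ℝ E) : Countable ι := by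
  refine Pairwise.countable_of_isOpen_disjoint (s := fun i => Metric.ball (b i) (1 / 2)) ?_
    (fun i => Metric.isOpen_ball) (fun i => ⟨b i, Metric.mem_ball_self (by norm_num)⟩)
  intro i j hij
  refine Metric.ball_disjoint_ball ?_
  have h : ‖b i - b j‖ * ‖b i - b j‖ = 2 := by
    rw [norm_sub_mul_self_real, b.orthonormal.2 hij, b.orthonormal.1, b.orthonormal.1]; norm_num
  rw [dist_eq_norm]
  nlinarith [norm_nonneg (b i - b j)]

variable {G : Type*} [Group G] [TopologicalSpace G]

theorem enorm_cplx (r : ℝ) : ‖(r : ℂ)‖ₑ = ‖r‖ₑ := by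
  rw [enorm_eq_nnnorm, enorm_eq_nnnorm, Complex.nnnorm_real]

theorem enorm_sq (f : Lp ℝ 2 (gam ι)) : ‖f‖ₑ ^ (2 : ℝ) = ∫⁻ x, ‖((f x : ℝ) : ℂ)‖ₑ ^ (2 : ℝ) ∂(gam ι) := by
  rw [Lp.enorm_def, eLpNorm_eq_lintegral_rpow_enorm_toReal (by norm_num) (by norm_num)]
  rw [← ENNReal.rpow_mul]
  simp_rw [enorm_cplx]
  norm_num

theorem hilbert_aux [SecondCountableTopology E] (b : HilbertBasis ι ℝ E) (ψ : G → NNReal)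
    (O : G → E →ₗᵢ[ℝ] E) (h1 : ∀ v, O 1 v = v) (hm : ∀ g h v, O (g * h) v = O g (O h v))
    (hOc : ∀ v, Continuous fun g => O g v) (β : G → E) (hβ : Continuous β)
    (hco : ∀ g h, β (g * h) = β g + O g (β h)) (hψ : ∀ g, (ψ g : ℝ≥0∞) = ‖β g‖ₑ ^ (2 : ℝ)) :
    Concl 2 ψ := by
  have := hb_countable b
  have := Encodable.ofCountable ι
  let f : ℕ → G → (ι → ℝ) → ℂ := fun k g x => match Encodable.decode (α := ι) k with
    | none => 0
    | some i => ((gW b (O g (b i)) x : ℝ) : ℂ)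
  have hf' : ∀ k i, Encodable.decode (α := ι) k = some i →
      f k = fun g x => ((gW b (O g (b i)) x : ℝ) : ℂ) := by
    intro k i h
    funext g x
    simp only [f, h]
  refine main_lemma (μ := gam ι) (p := 2) (by norm_num) ψ (fun g => gT b (O g)) (fun _ _ => 1)
    (fun g => gT_meas b _) (fun _ => measurable_const) (fun _ => by simp) ?_ ?_ ?_ f ?_ ?_
    (fun g x => ((gW b (β g) x : ℝ) : ℂ)) ?_ ?_ ?_ ?_
  · intro g F hF
    simp only [ENNReal.coe_one, one_mul]
    exact (gT_mp b (O g)).lintegral_comp hF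
  · filter_upwards [ae_all_iff.2 fun i => gX_coe (ι := ι) i] with x hx
    funext i
    simp only [gT, h1, gW_basis, hx, id]
  · intro g h
    filter_upwards [ae_all_iff.2 fun i => gW_comp b (O g) (O h (b i))] with x hx
    funext i
    simp only [gT, hm, Function.comp]
    exact (hx i).symm
  · intro g₀ k
    rcases hk : Encodable.decode (α := ι) k with _ | i
    · have : f k = fun _ _ => 0 := by funext g x; simp only [f, hk]
      rw [this]
      intro ε hε
      have hε' := hε.ne'
      simp [hε']
    · rw [hf' k i hk]
      have : TendstoInMeasure (gam ι) (fun g => gW b (O g (b i)) ) (𝓝 g₀) (gW b (O g₀ (b i))) :=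
        tendstoInMeasure_of_tendsto_Lp
          ((((gW b).continuous.comp (hOc (b i))).tendsto g₀))
      intro ε hε
      have h2 := this ε hε
      refine h2.congr fun g => ?_
      congr 1
      ext x
      simp only [Set.mem_ofPred_eq, edist_eq_enorm_sub]
      rw [← Complex.ofReal_sub, enorm_cplx]
  · intro g₀ s hs
    filter_upwards [hs] with y hy
    refine ⟨tendsto_const_nhds, tendsto_pi_nhds.2 fun i => ?_⟩
    have h2 := hy (Encodable.encode i)
    rw [hf' _ i (Encodable.encodek i)] at h2
    have h3 := (Complex.continuous_re.tendsto _).comp h2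
    simpa [Function.comp_def, gT] using h3
  · intro g
    have : ENNReal.ofReal 2 = 2 := by simp
    rw [this]
    exact (Lp.memLp (gW b (β g))).ofReal
  · intro g₀
    have e : ∀ g, ∫⁻ y, ‖((gW b (β g) y : ℝ) : ℂ) - ((gW b (β g₀) y : ℝ) : ℂ)‖ₑ ^ (2:ℝ) ∂(gam ι) =
        ‖β g - β g₀‖ₑ ^ (2 : ℝ) := by
      intro g
      have : ‖β g - β g₀‖ₑ = ‖gW b (β g - β g₀)‖ₑ := by rw [enorm_eq_nnnorm, enorm_eq_nnnorm, LinearIsometry.nnnorm_map]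
      rw [this, enorm_sq, map_sub]
      refine lintegral_congr_ae ?_
      filter_upwards [Lp.coeFn_sub (gW b (β g)) (gW b (β g₀))] with x hx
      rw [hx, Pi.sub_apply, Complex.ofReal_sub]
    simp_rw [e]
    have : Continuous fun g => ‖β g - β g₀‖ₑ ^ (2 : ℝ) := by fun_prop
    simpa using this.tendsto g₀
  · intro g h
    simp only [hco, map_add]
    filter_upwards [Lp.coeFn_add (gW b (β g)) (gW b (O g (β h))), gW_comp b (O g) (β h)] with x e1 e2
    rw [e1, Pi.add_apply, ← e2]
    simp
  · intro g
    rw [hψ, ← enorm_sq]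
    simp [enorm_eq_nnnorm]

theorem hilbert_case {E : Type} [NormedAddCommGroup E] [InnerProductSpace ℝ E] [CompleteSpace E]
    [SecondCountableTopology E] (ψ : G → NNReal)
    (O : G → E →ₗᵢ[ℝ] E) (h1 : ∀ v, O 1 v = v) (hm : ∀ g h v, O (g * h) v = O g (O h v))
    (hOc : ∀ v, Continuous fun g => O g v) (β : G → E) (hβ : Continuous β)
    (hco : ∀ g h, β (g * h) = β g + O g (β h)) (hψ : ∀ g, (ψ g : ℝ≥0∞) = ‖β g‖ₑ ^ (2 : ℝ)) :
    Concl 2 ψ := by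
  obtain ⟨w, b, -⟩ := exists_hilbertBasis ℝ E
  exact hilbert_aux b ψ O h1 hm hOc β hβ hco hψ

end

open MeasureTheory ENNReal

open Filter Topology

section
variable {X : Type} [MeasurableSpace X] {μ : Measure X}
variable {G : Type*} [Group G] [TopologicalSpace G]

theorem enorm_sq_cplx (f : Lp ℂ 2 μ) : ‖f‖ₑ ^ (2 : ℝ) = ∫⁻ x, ‖f x‖ₑ ^ (2 : ℝ) ∂μ := by
  rw [Lp.enorm_def, eLpNorm_eq_lintegral_rpow_enorm_toReal (by norm_num) (by norm_num)]
  rw [← ENNReal.rpow_mul]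
  norm_num

theorem cont_of_sq {F : G → Lp ℂ 2 μ}
    (h : ∀ g₀, Tendsto (fun g => ∫⁻ x, ‖(F g - F g₀ : Lp ℂ 2 μ) x‖ₑ ^ (2 : ℝ) ∂μ) (𝓝 g₀) (𝓝 0)) :
    Continuous F := by
  rw [continuous_iff_continuousAt]
  intro g₀
  rw [ContinuousAt, tendsto_iff_edist_tendsto_0]
  have h1 := h g₀
  simp_rw [← enorm_sq_cplx] at h1
  have h2 := ((ENNReal.continuous_rpow_const (y := (2 : ℝ)⁻¹)).tendsto 0).comp h1
  rw [ENNReal.zero_rpow_of_pos (by norm_num)] at h2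
  refine h2.congr fun g => ?_
  simp only [Function.comp]
  rw [← ENNReal.rpow_mul, edist_eq_enorm_sub]
  norm_num

theorem case_two_aux [StandardBorelSpace X] [SigmaFinite μ] {q : ℝ≥0∞} (hq : q = 2)
    (ψ : G → NNReal) (L : G → Lp ℂ q μ → Lp ℂ q μ) (β : G → Lp ℂ q μ)
    (hadd : ∀ g v w, L g (v + w) = L g v + L g w)
    (hsmul : ∀ g (t : ℝ) v, L g (t • v) = t • L g v)
    (hnorm : ∀ g v, ∫⁻ x, ‖L g v x‖ₑ ^ (2 : ℝ) ∂μ = ∫⁻ x, ‖v x‖ₑ ^ (2 : ℝ) ∂μ)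
    (h1 : ∀ v, L 1 v = v) (hm : ∀ g h v, L (g * h) v = L g (L h v))
    (hLc : ∀ v g₀, Tendsto (fun g => ∫⁻ x, ‖(L g v - L g₀ v : Lp ℂ q μ) x‖ₑ ^ (2 : ℝ) ∂μ)
      (𝓝 g₀) (𝓝 0))
    (hβ : ∀ g₀, Tendsto (fun g => ∫⁻ x, ‖(β g - β g₀ : Lp ℂ q μ) x‖ₑ ^ (2 : ℝ) ∂μ)
      (𝓝 g₀) (𝓝 0))
    (hco : ∀ g h, β (g * h) = β g + L g (β h))
    (hψ : ∀ g, (ψ g : ℝ≥0∞) = ∫⁻ x, ‖β g x‖ₑ ^ (2 : ℝ) ∂μ) : Concl 2 ψ := by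
  subst hq
  haveI : Fact ((2 : ℝ≥0∞) ≠ ⊤) := ⟨by norm_num⟩
  letI : InnerProductSpace ℝ (Lp ℂ 2 μ) := InnerProductSpace.rclikeToReal ℂ (Lp ℂ 2 μ)
  have hn : ∀ g v, ‖L g v‖ = ‖v‖ := by
    intro g v
    have h := hnorm g v
    rw [← enorm_sq_cplx, ← enorm_sq_cplx] at h
    have h' := ENNReal.rpow_left_injective (x := (2 : ℝ)) (by norm_num) h
    simpa [enorm_eq_nnnorm] using congrArg ENNReal.toReal h'
  exact hilbert_case ψ
    (fun g => { toFun := L g, map_add' := hadd g, map_smul' := hsmul g, norm_map' := hn g })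
    h1 hm (fun v => cont_of_sq (hLc v)) β (cont_of_sq hβ) hco
    (fun g => by rw [hψ, enorm_sq_cplx])

theorem case_two [StandardBorelSpace X] [SigmaFinite μ]
    (ψ : G → NNReal) (α : AffineIsometricAction G μ 2)
    (hψ : ∀ g : G, (ψ g : ℝ≥0∞) = pPow μ 2 ((α.act g 0 : X →ₘ[μ] ℂ))) : Concl 2 ψ :=
  case_two_aux (μ := μ) (q := ENNReal.ofReal 2) (by simp) ψ α.lin (fun g => α.act g 0) α.lin_add α.lin_smul
    α.lin_norm α.lin_one α.lin_mul (α.lin_cont (by norm_num)) (α.continuous 0) α.coc hψ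

end

end

/-- **Proposition (reduction to positive cocycles).** Let `G` be a topological group,
`p > 0`, and `ψ : G → ℝ≥0` continuous with `ψ(g) = ‖α_g(0)‖_p^p` for some continuous
affine isometric action `α` of `G` on an `L_p` space.  Then there are a standard
σ-finite measure space `(X,μ)`, a continuous nonsingular action `σ` of `G` on `(X,μ)`
and a continuous map `c : G → L_p(X,μ)` satisfying the cocycle identity
`c(gh) = c(g) + σ^{p,μ}(g) c(h)`, where
`σ^{p,μ}(g) f = (d(σ_g)_*μ/dμ)^{1/p} ⬝ (f ∘ σ_g⁻¹)`, such that `ψ(g) = ‖c(g)‖_p^p`. -/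
theorem stmt6 {G : Type*} [Group G] [TopologicalSpace G] [IsTopologicalGroup G]
    {p : ℝ} (hp : 0 < p) (ψ : G → NNReal) (hψ : Continuous ψ)
    (h : ∃ (X : Type) (_ : MeasurableSpace X) (μ : Measure X),
      StandardBorelSpace X ∧ SigmaFinite μ ∧
      ∃ α : AffineIsometricAction G μ p,
        ∀ g : G, (ψ g : ℝ≥0∞) = pPow μ p ((α.act g 0 : X →ₘ[μ] ℂ))) :
    ∃ (X : Type) (_ : MeasurableSpace X) (μ : Measure X),
      StandardBorelSpace X ∧ SigmaFinite μ ∧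
      ∃ (S : NonsingularAction G μ) (c : G → Lp ℂ (ENNReal.ofReal p) μ),
        (∀ g₀ : G, Filter.Tendsto
          (fun g => pPow μ p ((c g : X →ₘ[μ] ℂ) - (c g₀ : X →ₘ[μ] ℂ)))
          (nhds g₀) (nhds 0)) ∧
        (∀ g h' : G, (c (g * h') : X → ℂ) =ᵐ[μ]
          fun x => (c g : X → ℂ) x +
            ((((μ.map (S.σ g)).rnDeriv μ x).toReal ^ p⁻¹ : ℝ) : ℂ) *
              (c h' : X → ℂ) (S.σ g⁻¹ x)) ∧
        (∀ g : G, (ψ g : ℝ≥0∞) = pPow μ p ((c g : X →ₘ[μ] ℂ))) := by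
  obtain ⟨X, mX, μ, hX, hσ, α, hα⟩ := h
  by_cases h2 : p = 2
  · subst h2
    exact case_two ψ α hα
  · exact case_ne_two hp h2 ψ α hα
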